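/- Let (R,M) be a two-dimensional regular local ring with algebraically closed residue field and let I be a simple complete M-primary ideal of R. Then the set T(I) of Rees valuations of I consists of exactly one valuation w; in particular T(I) is contained in {v_M, w} and in fact T(I) = {w}. -/

import Mathlib

open IsLocalRing

/-- `x` is integral over the ideal `I`: it satisfies an equation
`x ^ n + c 1 * x ^ (n - 1) + ⋯ + c n = 0` with `c i ∈ I ^ i`. -/
def Ideal.IsIntegralElemOver {R : Type*} [CommRing R] (I : Ideal R) (x : R) : Prop :=
  ∃ n : ℕ, 0 < n ∧ ∃ c : ℕ → R, (∀ i ∈ Finset.Icc 1 n, c i ∈ I ^ i) ∧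
    x ^ n + ∑ i ∈ Finset.Icc 1 n, c i * x ^ (n - i) = 0

/-- An ideal is complete (integrally closed) if it contains every element integral over it. -/
def Ideal.IsComplete {R : Type*} [CommRing R] (I : Ideal R) : Prop :=
  ∀ x : R, I.IsIntegralElemOver x → x ∈ I

/-- An ideal is simple if it is proper and is not the product of two proper ideals. -/
def Ideal.IsSimpleIdeal {R : Type*} [CommRing R] (I : Ideal R) : Prop :=
  I ≠ ⊤ ∧ ∀ J K : Ideal R, I = J * K → J = ⊤ ∨ K = ⊤

/-- An ideal of a local ring is `M`-primary if its radical is the maximal ideal. -/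
def Ideal.IsMPrimary {R : Type*} [CommRing R] [IsLocalRing R] (I : Ideal R) : Prop :=
  I.radical = maximalIdeal R

/-- A discrete (rank one) valuation on `R`, recorded through its values in `ℕ∞` on
elements of `R`. -/
structure DiscreteValuationOn (R : Type*) [CommRing R] where
  v : R → ℕ∞
  v_zero : v 0 = ⊤
  v_one : v 1 = 0
  v_mul : ∀ x y, v (x * y) = v x + v y
  v_add : ∀ x y, min (v x) (v y) ≤ v (x + y)
  v_top_iff : ∀ x, v x = ⊤ ↔ x = 0
  v_nontrivial : ∃ x, v x ≠ 0 ∧ v x ≠ ⊤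

/-- The value `w(I)` of a valuation on an ideal: the minimum of `w` over `I`. -/
noncomputable def valIdeal {R : Type*} [CommRing R] (w : DiscreteValuationOn R)
    (I : Ideal R) : ℕ∞ :=
  ⨅ x ∈ I, w.v x

/-- `T` is the set of Rees valuations of `I`: a finite set of valuations such that the
integral closure of `I ^ m` is `{x | w x ≥ m ⬝ w(I) for all w ∈ T}` for every `m`, and
no proper subset of `T` has this property. -/
def IsReesValuationsOf {R : Type*} [CommRing R] (I : Ideal R)
    (T : Set (DiscreteValuationOn R)) : Prop :=
  T.Finite ∧
  (∀ (m : ℕ) (x : R), (I ^ m).IsIntegralElemOver x ↔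
      ∀ w ∈ T, (m : ℕ∞) * valIdeal w I ≤ w.v x) ∧
  ∀ T' ⊂ T, ¬ (∀ (m : ℕ) (x : R), (I ^ m).IsIntegralElemOver x ↔
      ∀ w ∈ T', (m : ℕ∞) * valIdeal w I ≤ w.v x)

/-- `w` is the `M`-adic order valuation `ord_R` of the local ring `R`:
`w x ≥ n` iff `x ∈ M ^ n`. -/
def IsOrdValuationOn {R : Type*} [CommRing R] [IsLocalRing R]
    (w : DiscreteValuationOn R) : Prop :=
  ∀ (n : ℕ) (x : R), (n : ℕ∞) ≤ w.v x ↔ x ∈ maximalIdeal R ^ n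

/-- The length of a module: the supremum of the lengths of strictly increasing chains of
submodules. -/
noncomputable def moduleLength (R M : Type*) [CommRing R] [AddCommGroup M] [Module R M] : ℕ∞ :=
  ⨆ (n : ℕ) (_ : ∃ c : Fin (n + 1) → Submodule R M, StrictMono c), (n : ℕ∞)

/-- The Hilbert–Samuel length function `n ↦ length (R / J ^ n)`. -/
noncomputable def hsLength {R : Type*} [CommRing R] (J : Ideal R) (n : ℕ) : ℕ∞ :=
  moduleLength R (R ⧸ J ^ n)

/-- `J` has (Hilbert–Samuel) multiplicity `e` in a one-dimensional ring:
eventually `length (R / J ^ n) = e * n + const`. -/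
def HasMultiplicity₁ {R : Type*} [CommRing R] (J : Ideal R) (e : ℕ∞) : Prop :=
  ∃ a b : ℕ, ∀ᶠ n : ℕ in Filter.atTop, hsLength J n + a = e * n + b

/-- `J` has (Hilbert–Samuel) multiplicity `e` in a two-dimensional ring:
eventually `length (R / J ^ n) = e * n ^ 2 / 2 +` lower order terms. -/
def HasMultiplicity₂ {R : Type*} [CommRing R] (J : Ideal R) (e : ℕ) : Prop :=
  ∃ a b a' b' : ℕ, ∀ᶠ n : ℕ in Filter.atTop,
    2 * hsLength J n + a * n + b = (e : ℕ∞) * n ^ 2 + a' * n + b'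

/-- `d` is the degree function coefficient `d(I, w)` of an ideal `I` whose unique Rees
valuation is `w`: for every nonzero `x ∈ M`, the degree function value
`d_I(x) = e((I + xR)/xR)` (a multiplicity in the one-dimensional ring `R/xR`) equals
`d ⬝ w(x)`. -/
def IsDegreeCoeffOfUnique {R : Type*} [CommRing R] [IsLocalRing R] (I : Ideal R)
    (w : DiscreteValuationOn R) (d : ℕ) : Prop :=
  ∀ x ∈ maximalIdeal R, x ≠ 0 →
    HasMultiplicity₁ (Ideal.map (Ideal.Quotient.mk (Ideal.span {x})) I) ((d : ℕ∞) * w.v x)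

set_option linter.unusedSectionVars false
universe u

section helpers
open Polynomial

theorem regular_prime {R : Type*} [CommRing R] [IsLocalRing R] [IsNoetherianRing R]
    (hd : 2 ≤ ringKrullDim R) {x y : R} (hM : maximalIdeal R = Ideal.span {x, y}) :
    (Ideal.span {x}).IsPrime ∧ y ∉ Ideal.span {x} := by
  have hxM : x ∈ maximalIdeal R := by rw [hM]; exact Ideal.subset_span (by simp)
  have hyM : y ∈ maximalIdeal R := by rw [hM]; exact Ideal.subset_span (by simp)
  have h1 : ∀ n : ℕ, y ^ n ∉ Ideal.span {x} := by
    intro n hn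
    have hmin : maximalIdeal R ∈ (Ideal.span {x}).minimalPrimes := by
      refine ⟨⟨inferInstance, ?_⟩, ?_⟩
      · rw [Ideal.span_singleton_le_iff_mem]; exact hxM
      · rintro q ⟨hq, hxq⟩ _
        rw [hM, Ideal.span_le]
        rintro z (rfl | rfl)
        · exact hxq (Ideal.mem_span_singleton_self _)
        · exact hq.mem_of_pow_mem n (hxq hn)
    have hh := Ideal.height_le_one_of_isPrincipal_of_mem_minimalPrimes _ _ hmin
    rw [← IsLocalRing.maximalIdeal_height_eq_ringKrullDim] at hd
    have h3 : ((2 : ℕ∞) : WithBot ℕ∞) ≤ ((1 : ℕ∞) : WithBot ℕ∞) :=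
      hd.trans (WithBot.coe_le_coe.mpr hh)
    have h4 := WithBot.coe_le_coe.mp h3
    exact absurd h4 (by decide)
  have hne : Ideal.span {x} ≠ ⊤ := fun h => h1 0 (by rw [h]; trivial)
  have h2 : ∀ z, z ∉ Ideal.span {x} → ∃ (n : ℕ) (u g : R), IsUnit u ∧ z = u * y ^ n + x * g := by
    intro z hz
    have : Nontrivial (R ⧸ Ideal.span {x}) := Ideal.Quotient.nontrivial_iff.mpr hne
    have : IsLocalRing (R ⧸ Ideal.span {x}) :=
      IsLocalRing.of_surjective' (Ideal.Quotient.mk _) Ideal.Quotient.mk_surjective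
    set yb : R ⧸ Ideal.span {x} := Ideal.Quotient.mk _ y with hyb
    have hJ : Ideal.span {yb} ≠ ⊤ := by
      intro h
      rw [Ideal.span_singleton_eq_top] at h
      have := h.exists_right_inv
      obtain ⟨c, hc⟩ := this
      obtain ⟨c, rfl⟩ := Ideal.Quotient.mk_surjective c
      rw [hyb, ← map_mul, ← map_one (Ideal.Quotient.mk _), Ideal.Quotient.eq] at hc
      have h5 : y * c - 1 ∈ maximalIdeal R :=
        (Ideal.span_singleton_le_iff_mem _).mpr hxM hc
      have := Ideal.sub_mem _ (Ideal.mul_mem_right c _ hyM) h5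
      simp at this
    have hk := Ideal.iInf_pow_eq_bot_of_isLocalRing _ hJ
    have hz0 : Ideal.Quotient.mk (Ideal.span {x}) z ≠ 0 := by
      rwa [Ne, Ideal.Quotient.eq_zero_iff_mem]
    have hex : ∃ n : ℕ, Ideal.Quotient.mk (Ideal.span {x}) z ∉ Ideal.span {yb} ^ n := by
      by_contra! hcon
      apply hz0
      rw [← Ideal.mem_bot, ← hk, Ideal.mem_iInf]
      exact hcon
    classical
    have hspec := Nat.find_spec hex
    have hmin := fun m => @Nat.find_min _ _ hex m
    set n := Nat.find hex with hn
    rcases n with _ | n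
    · simp at hspec
    have h6 := hmin n (by omega)
    rw [not_not, Ideal.span_singleton_pow, Ideal.mem_span_singleton] at h6
    rw [Ideal.span_singleton_pow, Ideal.mem_span_singleton] at hspec
    obtain ⟨c, hc⟩ := h6
    obtain ⟨c, rfl⟩ := Ideal.Quotient.mk_surjective c
    have hcu : IsUnit c := by
      by_contra hcn
      have : c ∈ maximalIdeal R := (mem_maximalIdeal c).mpr hcn
      rw [hM, Ideal.mem_span_pair] at this
      obtain ⟨a, b, hab⟩ := this
      apply hspec
      refine ⟨Ideal.Quotient.mk _ b, ?_⟩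
      have hx0 : Ideal.Quotient.mk (Ideal.span {x}) x = 0 :=
        Ideal.Quotient.eq_zero_iff_mem.mpr (Ideal.mem_span_singleton_self _)
      rw [hc, ← hab, map_add, map_mul, map_mul, hx0, ← hyb]
      ring
    rw [hyb, ← map_pow, ← map_mul, Ideal.Quotient.eq, Ideal.mem_span_singleton] at hc
    obtain ⟨g, hg⟩ := hc
    exact ⟨n, c, g, hcu, by linear_combination hg⟩
  refine ⟨⟨hne, ?_⟩, fun h => h1 1 (by simpa using h)⟩
  intro a b hab
  by_contra! hcon
  obtain ⟨n, u, g, hu, ha⟩ := h2 a hcon.1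
  obtain ⟨m, v, h, hv, hb⟩ := h2 b hcon.2
  apply h1 (n + m)
  rw [← Ideal.unit_mul_mem_iff_mem _ (hu.mul hv)]
  have : u * v * y ^ (n + m) = a * b - x * (u * y ^ n * h + g * v * y ^ m + x * g * h) := by
    rw [ha, hb]; ring
  rw [this]
  exact Ideal.sub_mem _ hab (Ideal.mul_mem_right _ _ (Ideal.mem_span_singleton_self _))

/-- A chart of the blowup of the maximal ideal. -/
structure BChart (R S : Type*) [CommRing R] [IsLocalRing R] [CommRing S] [Algebra R S] where
  x : R
  y : R
  t : S
  ρ : S →+* (ResidueField R)[X]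
  inj : Function.Injective (algebraMap R S)
  hM : maximalIdeal R = Ideal.span {x, y}
  hxt : algebraMap R S x * t = algebraMap R S y
  surj : ∀ s : S, ∃ P : R[X], aeval t P = s
  hρ : ∀ P : R[X], ρ (aeval t P) = P.map (residue R)
  prime : (Ideal.span {x}).IsPrime
  x0 : x ≠ 0
  ynot : y ∉ Ideal.span {x}

section pre
variable {R S : Type*} [CommRing R] [CommRing S] [Algebra R S] {x y : R} {t : S}

theorem hom_spec (hxt : algebraMap R S x * t = algebraMap R S y) (P : R[X]) (d : ℕ)
    (hP : P.natDegree ≤ d) :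
    algebraMap R S (∑ i ∈ Finset.range (d + 1), P.coeff i * (x ^ (d - i) * y ^ i)) =
      algebraMap R S x ^ d * aeval t P := by
  rw [aeval_eq_sum_range' (n := d + 1) (by omega), map_sum, Finset.mul_sum]
  refine Finset.sum_congr rfl fun i hi => ?_
  have hi' : i ≤ d := by simpa [Nat.lt_succ_iff] using hi
  rw [map_mul, map_mul, map_pow, map_pow, ← hxt, Algebra.smul_def, mul_pow]
  conv_rhs => rw [← Nat.sub_add_cancel hi', pow_add]
  ring

theorem lead_mem (hxt : algebraMap R S x * t = algebraMap R S y)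
    (inj : Function.Injective (algebraMap R S)) (hp : (Ideal.span {x}).IsPrime)
    (hy : y ∉ Ideal.span {x}) (P : R[X]) (d : ℕ)
    (hP : P.natDegree ≤ d) (h0 : aeval t P = 0) : P.coeff d ∈ Ideal.span {x} := by
  have h := hom_spec hxt P d hP
  rw [h0, mul_zero, ← map_zero (algebraMap R S)] at h
  have h := inj h
  rw [Finset.sum_range_succ] at h
  have h1 : ∑ i ∈ Finset.range d, P.coeff i * (x ^ (d - i) * y ^ i) ∈ Ideal.span {x} := by
    refine Ideal.sum_mem _ fun i hi => ?_
    have hi' : i < d := by simpa using hi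
    refine Ideal.mul_mem_left _ _ (Ideal.mul_mem_right _ _ ?_)
    exact Ideal.pow_mem_of_mem _ (Ideal.mem_span_singleton_self _) _ (by omega)
  have h2 : P.coeff d * y ^ d ∈ Ideal.span {x} := by
    have : P.coeff d * y ^ d = 0 - ∑ i ∈ Finset.range d, P.coeff i * (x ^ (d - i) * y ^ i) := by
      rw [← h]; simp
    rw [this]
    exact Ideal.sub_mem _ (Ideal.zero_mem _) h1
  rcases hp.mem_or_mem h2 with h3 | h3
  · exact h3
  · exact absurd (hp.mem_of_pow_mem _ h3) hy

theorem lower_deg (hxt : algebraMap R S x * t = algebraMap R S y) (P : R[X]) (d : ℕ)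
    (hP : P.natDegree ≤ d + 1) (hc : P.coeff (d + 1) ∈ Ideal.span {x}) :
    ∃ b : R, (P - C (x * b) * X ^ (d + 1) + C (b * y) * X ^ d).natDegree ≤ d ∧
      aeval t (P - C (x * b) * X ^ (d + 1) + C (b * y) * X ^ d) = aeval t P := by
  obtain ⟨b, hb⟩ := Ideal.mem_span_singleton.mp hc
  refine ⟨b, ?_, ?_⟩
  · rw [natDegree_le_iff_coeff_eq_zero]
    intro N hN
    rw [coeff_add, coeff_sub, coeff_C_mul_X_pow, coeff_C_mul_X_pow, if_neg (by omega : ¬ N = d)]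
    split_ifs with h
    · rw [h, hb]; ring
    · rw [coeff_eq_zero_of_natDegree_lt (by omega)]; ring
  · simp only [map_add, map_sub, map_mul, aeval_C, aeval_X, map_pow, ← hxt]
    ring

theorem map_residue_eq_zero [IsLocalRing R] (hxt : algebraMap R S x * t = algebraMap R S y)
    (inj : Function.Injective (algebraMap R S)) (hp : (Ideal.span {x}).IsPrime)
    (hy : y ∉ Ideal.span {x}) (hxM : residue R x = 0) (hyM : residue R y = 0) (d : ℕ) :
    ∀ P : R[X], P.natDegree ≤ d → aeval t P = 0 → P.map (residue R) = 0 := by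
  induction d with
  | zero =>
    intro P hP h0
    rw [eq_C_of_natDegree_le_zero hP] at h0 ⊢
    rw [aeval_C, ← map_zero (algebraMap R S)] at h0
    rw [inj h0]; simp
  | succ d ih =>
    intro P hP h0
    obtain ⟨b, h1, h2⟩ := lower_deg hxt P d hP (lead_mem hxt inj hp hy P _ hP h0)
    have := ih _ h1 (h2.trans h0)
    simpa [Polynomial.map_mul, hxM, hyM] using this

end pre

theorem exists_chart {R : Type u} [CommRing R] [IsLocalRing R] [IsNoetherianRing R] [IsDomain R]
    (hd : 2 ≤ ringKrullDim R) {x y : R} (hM : maximalIdeal R = Ideal.span {x, y}) :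
    ∃ (S : Type u) (_ : CommRing S) (_ : IsDomain S) (_ : IsNoetherianRing S) (_ : Algebra R S)
      (c : BChart R S), c.x = x ∧ c.y = y := by
  obtain ⟨hp, hy⟩ := regular_prime hd hM
  have hx0 : x ≠ 0 := by
    rintro rfl
    have hM' : maximalIdeal R = Ideal.span {y, 0} := by rw [hM, Set.pair_comm]
    have := (regular_prime hd hM').2
    exact this (Ideal.zero_mem _)
  have hxM : residue R x = 0 := by
    rw [residue_eq_zero_iff, hM]; exact Ideal.subset_span (by simp)
  have hyM : residue R y = 0 := by
    rw [residue_eq_zero_iff, hM]; exact Ideal.subset_span (by simp)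
  let K := FractionRing R
  let τ : K := algebraMap R K y / algebraMap R K x
  let S := Algebra.adjoin R {τ}
  let t : S := ⟨τ, Algebra.subset_adjoin rfl⟩
  have hxt : algebraMap R S x * t = algebraMap R S y := by
    apply Subtype.ext
    change algebraMap R K x * (algebraMap R K y / algebraMap R K x) = algebraMap R K y
    have : algebraMap R K x ≠ 0 := by simpa using hx0
    exact mul_div_cancel₀ _ this
  have inj : Function.Injective (algebraMap R S) := by
    intro a b hab
    exact IsFractionRing.injective R K (congrArg Subtype.val hab)
  have surj : ∀ s : S, ∃ P : R[X], aeval t P = s := by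
    rintro ⟨s, hs⟩
    have hs' := hs
    change s ∈ Algebra.adjoin R {τ} at hs'
    rw [Algebra.adjoin_singleton_eq_range_aeval] at hs'
    obtain ⟨P, hP⟩ := hs'
    refine ⟨P, Subtype.ext ?_⟩
    change S.val (aeval t P) = s
    rw [← aeval_algHom_apply]
    exact hP
  have hker : ∀ P : R[X], aeval t P = 0 → P.map (residue R) = 0 := fun P h =>
    map_residue_eq_zero hxt inj hp hy hxM hyM _ P le_rfl h
  let f : R[X] →+* S := (aeval t : R[X] →ₐ[R] S).toRingHom
  have hf : Function.Surjective f := surj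
  let ρ : S →+* (ResidueField R)[X] := f.liftOfSurjective hf ⟨mapRingHom (residue R), by
    intro P hP
    exact hker P hP⟩
  have hnoeth : IsNoetherianRing S := isNoetherianRing_of_surjective _ _ f hf
  refine ⟨S, inferInstance, inferInstance, hnoeth, inferInstance, ⟨x, y, t, ρ, inj, hM, hxt, surj, ?_,
    hp, hx0, hy⟩, rfl, rfl⟩
  intro P
  exact RingHom.liftOfRightInverse_comp_apply _ _ _ _ P


namespace BChart
variable {R S : Type*} [CommRing R] [IsLocalRing R] [CommRing S] [IsDomain S] [Algebra R S]
  (c : BChart R S)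

/-- elements of `S` of degree at most `n` in `t`. -/
def Deg (n : ℕ) (s : S) : Prop := ∃ P : R[X], P.natDegree ≤ n ∧ aeval c.t P = s

theorem deg_mono {n m : ℕ} (h : n ≤ m) {s : S} (hs : c.Deg n s) : c.Deg m s := by
  obtain ⟨P, hP, rfl⟩ := hs
  exact ⟨P, hP.trans h, rfl⟩

theorem exists_deg (s : S) : ∃ n, c.Deg n s := by
  obtain ⟨P, rfl⟩ := c.surj s
  exact ⟨_, P, le_rfl, rfl⟩

theorem rho_alg (a : R) : c.ρ (algebraMap R S a) = C (residue R a) := by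
  have := c.hρ (C a)
  simpa using this

theorem xM : c.x ∈ maximalIdeal R := by rw [c.hM]; exact Ideal.subset_span (by simp)

theorem yM : c.y ∈ maximalIdeal R := by rw [c.hM]; exact Ideal.subset_span (by simp)

theorem rho_x : c.ρ (algebraMap R S c.x) = 0 := by
  rw [rho_alg, (residue_eq_zero_iff _).mpr c.xM, C_0]

theorem rho_surj : Function.Surjective c.ρ := by
  intro p
  obtain ⟨P, rfl⟩ := map_surjective (residue R) residue_surjective p
  exact ⟨_, c.hρ P⟩

theorem phx0 : algebraMap R S c.x ≠ 0 := by
  intro h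
  rw [← map_zero (algebraMap R S)] at h
  exact c.x0 (c.inj h)

theorem alg_mem_of_M {a : R} (ha : a ∈ maximalIdeal R) :
    algebraMap R S c.x ∣ algebraMap R S a := by
  rw [c.hM, Ideal.mem_span_pair] at ha
  obtain ⟨p, q, rfl⟩ := ha
  refine ⟨algebraMap R S p + algebraMap R S q * c.t, ?_⟩
  simp only [map_add, map_mul, ← c.hxt]
  ring

theorem rho_eq_zero {s : S} : c.ρ s = 0 ↔ algebraMap R S c.x ∣ s := by
  constructor
  · intro h
    obtain ⟨P, rfl⟩ := c.surj s
    rw [c.hρ] at h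
    rw [aeval_eq_sum_range]
    refine Finset.dvd_sum fun i _ => ?_
    rw [Algebra.smul_def]
    refine Dvd.dvd.mul_right (c.alg_mem_of_M ?_) _
    rw [← residue_eq_zero_iff, ← coeff_map, h, coeff_zero]
  · rintro ⟨s, rfl⟩
    rw [map_mul, rho_x, zero_mul]

theorem deg_of_mem_pow (n : ℕ) {z : R} (hz : z ∈ maximalIdeal R ^ n) :
    ∃ s, c.Deg n s ∧ algebraMap R S z = algebraMap R S c.x ^ n * s := by
  induction n generalizing z with
  | zero => exact ⟨algebraMap R S z, ⟨C z, by simp, by simp⟩, by simp⟩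
  | succ n ih =>
    rw [pow_succ'] at hz
    refine Submodule.mul_induction_on hz ?_ ?_
    · intro m hm z hz
      obtain ⟨_, ⟨P, hP, rfl⟩, h⟩ := ih hz
      rw [c.hM, Ideal.mem_span_pair] at hm
      obtain ⟨p, q, rfl⟩ := hm
      refine ⟨_, ⟨(C p + C q * X) * P, ?_, rfl⟩, ?_⟩
      · refine natDegree_mul_le.trans ?_
        have : (C p + C q * X).natDegree ≤ 1 := by
          rw [add_comm]; exact natDegree_linear_le
        omega
      · simp only [map_add, map_mul, h, aeval_C, aeval_X, ← c.hxt]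
        ring
    · rintro a b ⟨_, ⟨P, hP, rfl⟩, h⟩ ⟨_, ⟨Q, hQ, rfl⟩, h'⟩
      refine ⟨_, ⟨P + Q, natDegree_add_le_of_degree_le hP hQ, rfl⟩, ?_⟩
      rw [map_add, map_add, h, h']; ring

theorem mono_mem (n i : ℕ) (h : i ≤ n) : c.x ^ (n - i) * c.y ^ i ∈ maximalIdeal R ^ n := by
  have : maximalIdeal R ^ n = maximalIdeal R ^ (n - i) * maximalIdeal R ^ i := by
    rw [← pow_add, Nat.sub_add_cancel h]
  rw [this]
  exact Ideal.mul_mem_mul (Ideal.pow_mem_pow c.xM _) (Ideal.pow_mem_pow c.yM _)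

theorem mem_pow_of_deg (n : ℕ) {z : R} {s : S} (hs : c.Deg n s)
    (h : algebraMap R S z = algebraMap R S c.x ^ n * s) : z ∈ maximalIdeal R ^ n := by
  obtain ⟨P, hP, rfl⟩ := hs
  rw [← hom_spec c.hxt P n hP] at h
  rw [c.inj h]
  refine Ideal.sum_mem _ fun i hi => Ideal.mul_mem_left _ _ (c.mono_mem n i ?_)
  simpa [Nat.lt_succ_iff] using hi

theorem cancel (n : ℕ) {s s' : S}
    (h : algebraMap R S c.x ^ n * s = algebraMap R S c.x ^ n * s') : s = s' :=
  mul_left_cancel₀ (pow_ne_zero _ c.phx0) h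

theorem mem_pow_succ (n : ℕ) {z : R} {s : S} (hz : z ∈ maximalIdeal R ^ n)
    (h : algebraMap R S z = algebraMap R S c.x ^ n * s) :
    z ∈ maximalIdeal R ^ (n + 1) ↔ c.ρ s = 0 := by
  constructor
  · intro h1
    obtain ⟨s', -, h2⟩ := c.deg_of_mem_pow _ h1
    rw [h, pow_succ, mul_assoc] at h2
    rw [c.cancel _ h2, map_mul, rho_x, zero_mul]
  · intro h1
    obtain ⟨s', ⟨P, hP, rfl⟩, h2⟩ := c.deg_of_mem_pow _ hz
    rw [h] at h2
    rw [c.cancel _ h2, c.hρ] at h1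
    rw [c.cancel _ h2, ← hom_spec c.hxt P n hP] at h
    rw [c.inj h]
    refine Ideal.sum_mem _ fun i hi => ?_
    rw [pow_succ']
    refine Ideal.mul_mem_mul ?_ (c.mono_mem n i (by simpa [Nat.lt_succ_iff] using hi))
    rw [← residue_eq_zero_iff, ← coeff_map, h1, coeff_zero]

theorem mem_pow_of_dvd (n : ℕ) {z : R} {s : S}
    (h : algebraMap R S z = algebraMap R S c.x ^ n * s) : z ∈ maximalIdeal R ^ n := by
  have : ∀ j, j ≤ n → z ∈ maximalIdeal R ^ j := by
    intro j
    induction j with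
    | zero => simp
    | succ j ih =>
      intro hj
      have h1 := ih (by omega)
      refine (c.mem_pow_succ j h1 (s := algebraMap R S c.x ^ (n - j) * s) ?_).mpr ?_
      · rw [h, ← mul_assoc, ← pow_add]; congr 2; omega
      · rw [map_mul, map_pow, rho_x, zero_pow (by omega), zero_mul]
  exact this n le_rfl

theorem deg_iff (n : ℕ) (s : S) :
    c.Deg n s ↔ ∃ z, algebraMap R S z = algebraMap R S c.x ^ n * s := by
  constructor
  · rintro ⟨P, hP, rfl⟩
    exact ⟨_, hom_spec c.hxt P n hP⟩
  · rintro ⟨z, h⟩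
    obtain ⟨s', h1, h2⟩ := c.deg_of_mem_pow _ (c.mem_pow_of_dvd n h)
    rw [h] at h2
    rwa [c.cancel _ h2]

theorem deg_add {n : ℕ} {s s' : S} (h : c.Deg n s) (h' : c.Deg n s') : c.Deg n (s + s') := by
  obtain ⟨P, hP, rfl⟩ := h
  obtain ⟨Q, hQ, rfl⟩ := h'
  exact ⟨P + Q, natDegree_add_le_of_degree_le hP hQ, map_add _ _ _⟩

theorem deg_sub {n : ℕ} {s s' : S} (h : c.Deg n s) (h' : c.Deg n s') : c.Deg n (s - s') := by
  obtain ⟨P, hP, rfl⟩ := h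
  obtain ⟨Q, hQ, rfl⟩ := h'
  exact ⟨P - Q, (natDegree_sub_le _ _).trans (max_le hP hQ), map_sub _ _ _⟩

theorem deg_mul {n m : ℕ} {s s' : S} (h : c.Deg n s) (h' : c.Deg m s') :
    c.Deg (n + m) (s * s') := by
  obtain ⟨P, hP, rfl⟩ := h
  obtain ⟨Q, hQ, rfl⟩ := h'
  exact ⟨P * Q, natDegree_mul_le.trans (by omega), map_mul _ _ _⟩

theorem rho_natDegree_le {n : ℕ} {s : S} (h : c.Deg n s) : (c.ρ s).natDegree ≤ n := by
  obtain ⟨P, hP, rfl⟩ := h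
  rw [c.hρ]
  exact natDegree_map_le.trans hP

/-- Monic division lemma. -/
theorem deg_of_monic_mul {a n : ℕ} {A : R[X]} (hA : A.Monic) (ha : A.natDegree = a) {s : S}
    (h : c.Deg (a + n) (aeval c.t A * s)) : c.Deg n s := by
  have key : ∀ d, c.Deg (n + d) s → c.Deg n s := by
    intro d
    induction d with
    | zero => exact id
    | succ d ih =>
      intro hs
      apply ih
      obtain ⟨P, hP, rfl⟩ := hs
      obtain ⟨Q, hQ, hQs⟩ := h
      have h0 : aeval c.t (A * P - Q) = 0 := by rw [map_sub, map_mul, hQs, sub_self]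
      have hdeg : (A * P - Q).natDegree ≤ a + (n + (d + 1)) := by
        refine (natDegree_sub_le _ _).trans (max_le ?_ (by omega))
        exact natDegree_mul_le.trans (by omega)
      have h1 := lead_mem c.hxt c.inj c.prime c.ynot _ _ hdeg h0
      rw [coeff_sub, coeff_eq_zero_of_natDegree_lt (p := Q) (by omega), sub_zero,
        coeff_mul_add_eq_of_natDegree_le ha.le hP] at h1
      have h2 : A.coeff a = 1 := by rw [← ha]; exact hA
      rw [h2, one_mul] at h1
      obtain ⟨b, h3, h4⟩ := lower_deg c.hxt P (n + d) hP h1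
      exact ⟨_, h3, h4⟩
  obtain ⟨m, hm⟩ := c.exists_deg s
  exact key m (c.deg_mono (by omega) hm)

theorem exists_div {a : ℕ} {A : R[X]} (hA : A.Monic) (ha : A.natDegree = a) (s : S) :
    ∃ s1 s0, s = aeval c.t A * s1 + s0 ∧ c.Deg a s0 := by
  obtain ⟨P, rfl⟩ := c.surj s
  refine ⟨aeval c.t (P /ₘ A), aeval c.t (P %ₘ A), ?_, _, ?_, rfl⟩
  · rw [← map_mul, ← map_add, add_comm, modByMonic_add_div]
  · rw [← ha]; exact natDegree_modByMonic_le _ hA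

/-- Weierstrass preparation modulo powers of `x`. -/
theorem weierstrass (J : Ideal S) (e : ℕ) (he : algebraMap R S c.x ^ e ∈ J)
    {p : (ResidueField R)[X]} (hp : p.Monic) (hpJ : ∃ j ∈ J, c.ρ j = p) :
    ∃ A : R[X], A.Monic ∧ A.natDegree = p.natDegree ∧ aeval c.t A ∈ J := by
  set ξ := algebraMap R S c.x with hξ
  have key : ∀ m : ℕ, ∃ A : R[X], A.Monic ∧ A.natDegree = p.natDegree ∧ A.map (residue R) = p ∧
      ∃ j ∈ J, ∃ h, aeval c.t A = j + ξ ^ (m + 1) * h := by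
    intro m
    induction m with
    | zero =>
      obtain ⟨j, hj, hjp⟩ := hpJ
      have hl : p ∈ lifts (residue R) := (mem_lifts _).mpr (map_surjective _ residue_surjective p)
      obtain ⟨A, hA1, hA2, hA3⟩ := lifts_and_natDegree_eq_and_monic hl hp
      refine ⟨A, hA3, hA2, hA1, j, hj, ?_⟩
      have : c.ρ (aeval c.t A - j) = 0 := by rw [map_sub, c.hρ, hA1, hjp, sub_self]
      obtain ⟨h, hh⟩ := c.rho_eq_zero.mp this
      exact ⟨h, by rw [zero_add, pow_one, hξ, ← hh]; ring⟩
    | succ m ih =>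
      obtain ⟨A, hA, hAd, hAp, j, hj, h, hh⟩ := ih
      obtain ⟨H, hH⟩ := c.surj h
      set q := aeval c.t (H /ₘ A) with hq
      set B := H %ₘ A with hB
      have hdiv : h = aeval c.t A * q + aeval c.t B := by
        rw [hq, hB, ← map_mul, ← map_add, add_comm (A * _), modByMonic_add_div, hH]
      have hlt : (C (c.x ^ (m + 1)) * B).degree < A.degree :=
        (by rw [← smul_eq_C_mul]; exact (degree_smul_le _ _).trans_lt (degree_modByMonic_lt _ hA))
      refine ⟨A - C (c.x ^ (m + 1)) * B, hA.sub_of_left hlt, ?_, ?_,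
        (1 + ξ ^ (m + 1) * q) * j, J.mul_mem_left _ hj, ?_⟩
      · rw [← hAd]
        exact natDegree_eq_of_degree_eq (degree_sub_eq_left_of_degree_lt hlt)
      · rw [Polynomial.map_sub, Polynomial.map_mul, map_C, map_pow,
          (residue_eq_zero_iff _).mpr c.xM, hAp]
        simp
      · refine ⟨ξ ^ m * (q * q * aeval c.t A + q * aeval c.t B), ?_⟩
        have e1 : aeval c.t (A - C (c.x ^ (m + 1)) * B) =
            aeval c.t A - ξ ^ (m + 1) * aeval c.t B := by
          simp [hξ]
        have e2 : j = aeval c.t A - ξ ^ (m + 1) * (aeval c.t A * q + aeval c.t B) := by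
          rw [← hdiv, hh]; ring
        rw [e1, e2]
        ring
  obtain ⟨A, h1, h2, -, j, hj, h, hh⟩ := key e
  refine ⟨A, h1, h2, ?_⟩
  rw [hh]
  refine J.add_mem hj (J.mul_mem_right _ ?_)
  rw [pow_succ]
  exact J.mul_mem_right _ he

/-- contraction of `x ^ n J`. -/
def contr (n : ℕ) (J : Ideal S) : Ideal R :=
  (Ideal.span {algebraMap R S c.x ^ n} * J).comap (algebraMap R S)

theorem mem_contr {n : ℕ} {J : Ideal S} {z : R} :
    z ∈ c.contr n J ↔ ∃ s ∈ J, algebraMap R S z = algebraMap R S c.x ^ n * s := by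
  rw [contr, Ideal.mem_comap, Ideal.mem_span_singleton_mul]
  simp only [eq_comm]

theorem contr_le (n : ℕ) (J : Ideal S) : c.contr n J ≤ maximalIdeal R ^ n := by
  intro z hz
  obtain ⟨s, -, h⟩ := c.mem_contr.mp hz
  exact c.mem_pow_of_dvd n h

theorem contr_mul_le (n m : ℕ) (J K : Ideal S) :
    c.contr n J * c.contr m K ≤ c.contr (n + m) (J * K) := by
  rw [Ideal.mul_le]
  intro a ha b hb
  obtain ⟨s, hs, h⟩ := c.mem_contr.mp ha
  obtain ⟨s', hs', h'⟩ := c.mem_contr.mp hb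
  refine c.mem_contr.mpr ⟨s * s', Ideal.mul_mem_mul hs hs', ?_⟩
  rw [map_mul, h, h']; ring

theorem contr_top (n : ℕ) : c.contr n ⊤ = maximalIdeal R ^ n := by
  refine le_antisymm (c.contr_le _ _) fun z hz => ?_
  obtain ⟨s, -, h⟩ := c.deg_of_mem_pow n hz
  exact c.mem_contr.mpr ⟨s, trivial, h⟩

theorem contr_mul {J K : Ideal S} {a b : ℕ} (n : ℕ) {A B : R[X]} (hA : A.Monic)
    (ha : A.natDegree = a) (hB : B.Monic) (hb : B.natDegree = b)
    (hAJ : aeval c.t A ∈ J) (hBK : aeval c.t B ∈ K) :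
    c.contr (n + (a + b)) (J * K) = maximalIdeal R ^ n * (c.contr a J * c.contr b K) := by
  set ξ := algebraMap R S c.x with hξ
  set α := aeval c.t A with hα
  set β := aeval c.t B with hβ
  have hAd : c.Deg a α := ⟨A, ha.le, rfl⟩
  have hBd : c.Deg b β := ⟨B, hb.le, rfl⟩
  apply le_antisymm
  · -- elements which are sums of products of low degree elements
    have hprod : ∀ j ∈ J, ∀ k ∈ K, c.Deg a j → c.Deg b k →
        ∃ z ∈ c.contr a J * c.contr b K, algebraMap R S z = ξ ^ (a + b) * (j * k) := by
      intro j hj k hk hja hkb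
      obtain ⟨z, hz⟩ := (c.deg_iff _ _).mp hja
      obtain ⟨z', hz'⟩ := (c.deg_iff _ _).mp hkb
      refine ⟨z * z', Ideal.mul_mem_mul (c.mem_contr.mpr ⟨j, hj, hz⟩)
        (c.mem_contr.mpr ⟨k, hk, hz'⟩), ?_⟩
      rw [map_mul, hz, hz']; ring
    have hdivJ : ∀ j ∈ J, ∃ s1 j0, j = α * s1 + j0 ∧ c.Deg a j0 ∧ j0 ∈ J := by
      intro j hj
      obtain ⟨s1, j0, h1, h2⟩ := c.exists_div hA ha j
      refine ⟨s1, j0, h1, h2, ?_⟩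
      have : j0 = j - α * s1 := by rw [h1]; ring
      rw [this]; exact J.sub_mem hj (J.mul_mem_right _ hAJ)
    have hdivK : ∀ k ∈ K, ∃ s1 k0, k = β * s1 + k0 ∧ c.Deg b k0 ∧ k0 ∈ K := by
      intro k hk
      obtain ⟨s1, k0, h1, h2⟩ := c.exists_div hB hb k
      refine ⟨s1, k0, h1, h2, ?_⟩
      have : k0 = k - β * s1 := by rw [h1]; ring
      rw [this]; exact K.sub_mem hk (K.mul_mem_right _ hBK)
    have key : ∀ i ∈ J * K, ∃ s, ∃ z ∈ c.contr a J * c.contr b K,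
        algebraMap R S z = ξ ^ (a + b) * (i - α * β * s) := by
      intro i hi
      refine Submodule.mul_induction_on hi ?_ ?_
      · intro j hj k hk
        obtain ⟨s1, j0, h1, h2, h3⟩ := hdivJ j hj
        obtain ⟨s2, k0, h4, h5, h6⟩ := hdivK k hk
        obtain ⟨s3, k1, h7, h8, h9⟩ := hdivK (s1 * k0) (K.mul_mem_left _ h6)
        obtain ⟨s4, j1, h10, h11, h12⟩ := hdivJ (s2 * j0) (J.mul_mem_left _ h3)
        obtain ⟨z1, hz1, e1⟩ := hprod α hAJ k1 h9 hAd h8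
        obtain ⟨z2, hz2, e2⟩ := hprod j1 h12 β hBK h11 hBd
        obtain ⟨z3, hz3, e3⟩ := hprod j0 h3 k0 h6 h2 h5
        refine ⟨s1 * s2 + s3 + s4, z1 + z2 + z3,
          Ideal.add_mem _ (Ideal.add_mem _ hz1 hz2) hz3, ?_⟩
        rw [map_add, map_add, e1, e2, e3, h1, h4]
        have e4 : k1 = s1 * k0 - β * s3 := by rw [h7]; ring
        have e5 : j1 = s2 * j0 - α * s4 := by rw [h10]; ring
        rw [e4, e5]; ring
      · rintro i i' ⟨s, z, hz, h⟩ ⟨s', z', hz', h'⟩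
        refine ⟨s + s', z + z', Ideal.add_mem _ hz hz', ?_⟩
        rw [map_add, h, h']; ring
    intro z hz
    obtain ⟨i, hi, h⟩ := c.mem_contr.mp hz
    obtain ⟨s, z1, hz1, h1⟩ := key i hi
    have hi1 : c.Deg ((a + b) + n) i := by
      rw [c.deg_iff]; exact ⟨z, by rw [h]; congr 2; omega⟩
    have hi2 : c.Deg (a + b) (i - α * β * s) := by
      rw [c.deg_iff]; exact ⟨z1, h1⟩
    have hi3 : c.Deg ((a + b) + n) (aeval c.t (A * B) * s) := by
      have := c.deg_sub hi1 (c.deg_mono (by omega : a + b ≤ a + b + n) hi2)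
      rw [map_mul]
      convert this using 1
      ring
    have hs : c.Deg n s := c.deg_of_monic_mul (hA.mul hB)
      (by rw [hA.natDegree_mul hB, ha, hb]) hi3
    obtain ⟨zs, hzs⟩ := (c.deg_iff _ _).mp hs
    obtain ⟨z2, hz2, h2⟩ := hprod α hAJ β hBK hAd hBd
    have hz : z = c.x ^ n * z1 + zs * z2 := by
      apply c.inj
      rw [h, map_add, map_mul, map_mul, h1, hzs, h2, map_pow, ← hξ]
      ring
    rw [hz]
    refine Ideal.add_mem _ (Ideal.mul_mem_mul (Ideal.pow_mem_pow c.xM _) hz1)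
      (Ideal.mul_mem_mul (c.mem_pow_of_dvd n hzs) hz2)
  · rw [← c.contr_top n]
    refine (Ideal.mul_mono_right (c.contr_mul_le a b J K)).trans ?_
    refine (c.contr_mul_le _ _ _ _).trans ?_
    rw [Ideal.top_mul]

theorem contr_pow {J : Ideal S} {a : ℕ} {A : R[X]} (hA : A.Monic) (ha : A.natDegree = a)
    (hAJ : aeval c.t A ∈ J) (m : ℕ) : c.contr (m * a) (J ^ m) = c.contr a J ^ m := by
  induction m with
  | zero => rw [zero_mul, pow_zero, pow_zero, Ideal.one_eq_top, c.contr_top, pow_zero, Ideal.one_eq_top]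
  | succ m ih =>
    have := c.contr_mul (J := J ^ m) (K := J) 0 (hA.pow m) (by rw [hA.natDegree_pow, ha]) hA ha
      (by rw [map_pow]; exact Ideal.pow_mem_pow hAJ m) hAJ
    rw [pow_zero, one_mul, zero_add, ih] at this
    rw [pow_succ, pow_succ, ← this]
    congr 1; ring

end BChart


namespace DiscreteValuationOn
variable {R : Type*} [CommRing R] (w : DiscreteValuationOn R)

theorem v_pow (z : R) (n : ℕ) : w.v (z ^ n) = n * w.v z := by
  induction n with
  | zero => simp [w.v_one]
  | succ n ih => rw [pow_succ, w.v_mul, ih]; push_cast; ring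

theorem v_unit {u : R} (hu : IsUnit u) : w.v u = 0 := by
  obtain ⟨v, hv⟩ := hu.exists_right_inv
  have := w.v_mul u v
  rw [hv, w.v_one] at this
  have := this.symm
  rw [add_eq_zero] at this
  exact this.1

theorem v_neg (z : R) : w.v (-z) = w.v z := by
  have : -z = (-1) * z := by ring
  rw [this, w.v_mul, w.v_unit (isUnit_one.neg), zero_add]

theorem ne_top {z : R} (hz : z ≠ 0) : w.v z ≠ ⊤ := fun h => hz ((w.v_top_iff z).mp h)

theorem nontriv (w : DiscreteValuationOn R) : Nontrivial R := by
  refine ⟨0, 1, fun h => ?_⟩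
  have h1 := w.v_one
  rw [← h, w.v_zero] at h1
  exact absurd h1 (by simp)

theorem isDomain (w : DiscreteValuationOn R) : IsDomain R := by
  have := w.nontriv
  have : NoZeroDivisors R := ⟨by
    intro a b hab
    have := w.v_mul a b
    rw [hab, w.v_zero] at this
    have := this.symm
    rw [ENat.add_eq_top] at this
    rw [← w.v_top_iff, ← w.v_top_iff]; exact this⟩
  exact NoZeroDivisors.to_isDomain R

/-- The valuation ideal. -/
def vIdeal (n : ℕ∞) : Ideal R where
  carrier := {z | n ≤ w.v z}
  zero_mem' := by simp [w.v_zero]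
  add_mem' := fun {a b} ha hb => (le_min ha hb).trans (w.v_add a b)
  smul_mem' := fun a b hb => by
    simp only [Set.mem_ofPred_eq, smul_eq_mul, w.v_mul] at *
    exact hb.trans le_add_self

theorem mem_vIdeal {n : ℕ∞} {z : R} : z ∈ w.vIdeal n ↔ n ≤ w.v z := Iff.rfl

end DiscreteValuationOn

theorem enat_cancel {a b c : ℕ∞} (hc : c ≠ ⊤) (h : a + c = b + c) : a = b :=
  (ENat.add_left_injective_of_ne_top hc) h

theorem enat_le_cancel {a b c : ℕ∞} (hc : c ≠ ⊤) (h : a + c ≤ b + c) : a ≤ b :=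
  (ENat.add_le_add_iff_right hc).mp h

theorem exists_extension {A B : Type*} [CommRing A] [CommRing B] [IsDomain B]
    (φ : A →+* B) (hφ : Function.Injective φ) (w : DiscreteValuationOn A)
    (h : ∀ s : B, ∃ a b, b ≠ 0 ∧ φ b * s = φ a ∧ w.v b ≤ w.v a) :
    ∃ w' : DiscreteValuationOn B, ∀ a, w'.v (φ a) = w.v a := by
  have hA : IsDomain A := w.isDomain
  choose num den h0 h1 h2 using h
  let v : B → ℕ∞ := fun s => w.v (num s) - w.v (den s)
  have key : ∀ s a b, b ≠ 0 → φ b * s = φ a → v s + w.v b = w.v a := by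
    intro s a b hb hab
    have e1 : v s + w.v (den s) = w.v (num s) := tsub_add_cancel_of_le (h2 s)
    have e2 : b * num s = den s * a := by
      apply hφ
      rw [map_mul, map_mul, ← h1, ← hab]; ring
    have e3 := congrArg w.v e2
    rw [w.v_mul, w.v_mul] at e3
    apply enat_cancel (w.ne_top (h0 s))
    rw [add_right_comm, e1, add_comm, e3, add_comm]
  have hv : ∀ a, v (φ a) = w.v a := by
    intro a
    have := key (φ a) a 1 one_ne_zero (by simp)
    rwa [w.v_one, add_zero] at this
  refine ⟨⟨v, ?_, ?_, ?_, ?_, ?_, ?_⟩, hv⟩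
  · rw [← map_zero φ, hv, w.v_zero]
  · rw [← map_one φ, hv, w.v_one]
  · intro s s'
    have hd : den s * den s' ≠ 0 := mul_ne_zero (h0 s) (h0 s')
    apply enat_cancel (w.ne_top hd)
    rw [key (s * s') (num s * num s') (den s * den s') hd
      (by rw [map_mul, map_mul, ← h1 s, ← h1 s']; ring), w.v_mul, w.v_mul,
      ← key s _ _ (h0 s) (h1 s), ← key s' _ _ (h0 s') (h1 s')]
    ring
  · intro s s'
    have hd : den s * den s' ≠ 0 := mul_ne_zero (h0 s) (h0 s')
    apply enat_le_cancel (w.ne_top hd)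
    rw [key (s + s') (num s * den s' + num s' * den s) (den s * den s') hd
      (by rw [map_add, map_mul, map_mul, map_mul, ← h1 s, ← h1 s']; ring)]
    refine le_trans ?_ (w.v_add _ _)
    rw [w.v_mul, w.v_mul, w.v_mul, ← key s _ _ (h0 s) (h1 s), ← key s' _ _ (h0 s') (h1 s')]
    apply le_min
    · rw [add_assoc]; gcongr; exact min_le_left _ _
    · rw [add_assoc, add_comm (w.v (den s'))]; gcongr; exact min_le_right _ _
  · intro s
    constructor
    · intro hs
      have := key s _ _ (h0 s) (h1 s)
      rw [hs, top_add] at this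
      have h3 := (w.v_top_iff _).mp this.symm
      have h4 := h1 s
      rw [h3, map_zero] at h4
      rcases mul_eq_zero.mp h4 with h5 | h5
      · exact absurd (hφ (h5.trans (map_zero φ).symm)) (h0 s)
      · exact h5
    · rintro rfl
      rw [← map_zero φ, hv, w.v_zero]
  · obtain ⟨z, hz⟩ := w.v_nontrivial
    exact ⟨φ z, by rwa [hv]⟩

theorem exists_order {R : Type*} [CommRing R] [IsLocalRing R] [IsNoetherianRing R]
    {z : R} (hz : z ≠ 0) : ∃ n, z ∈ maximalIdeal R ^ n ∧ z ∉ maximalIdeal R ^ (n + 1) := by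
  have hk := Ideal.iInf_pow_eq_bot_of_isLocalRing (maximalIdeal R) Ideal.IsPrime.ne_top'
  have hex : ∃ n : ℕ, z ∉ maximalIdeal R ^ n := by
    by_contra! hcon
    apply hz
    rw [← Ideal.mem_bot, ← hk, Ideal.mem_iInf]
    exact hcon
  classical
  have h1 := Nat.find_spec hex
  have h2 := fun m => @Nat.find_min _ _ hex m
  set n := Nat.find hex
  rcases n with _ | n
  · simp at h1
  · exact ⟨n, not_not.mp (h2 n (by omega)), h1⟩

theorem BChart.order_mul {R S : Type*} [CommRing R] [IsLocalRing R] [CommRing S] [IsDomain S]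
    [Algebra R S] (c : BChart R S) {a b : R} {n m : ℕ}
    (ha : a ∈ maximalIdeal R ^ n) (ha' : a ∉ maximalIdeal R ^ (n + 1))
    (hb : b ∈ maximalIdeal R ^ m) (hb' : b ∉ maximalIdeal R ^ (m + 1)) :
    a * b ∈ maximalIdeal R ^ (n + m) ∧ a * b ∉ maximalIdeal R ^ (n + m + 1) := by
  have h1 : a * b ∈ maximalIdeal R ^ (n + m) := by rw [pow_add]; exact Ideal.mul_mem_mul ha hb
  refine ⟨h1, ?_⟩
  obtain ⟨s, -, hs⟩ := c.deg_of_mem_pow n ha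
  obtain ⟨s', -, hs'⟩ := c.deg_of_mem_pow m hb
  rw [c.mem_pow_succ n ha hs] at ha'
  rw [c.mem_pow_succ m hb hs'] at hb'
  rw [c.mem_pow_succ (n + m) h1 (s := s * s') (by rw [map_mul, hs, hs']; ring), map_mul]
  exact mul_ne_zero ha' hb'

theorem BChart.exists_ord {R S : Type*} [CommRing R] [IsLocalRing R] [IsNoetherianRing R]
    [CommRing S] [IsDomain S]
    [Algebra R S] (c : BChart R S) : ∃ w : DiscreteValuationOn R,
      ∀ (n : ℕ) (z : R), (n : ℕ∞) ≤ w.v z ↔ z ∈ maximalIdeal R ^ n := by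
  classical
  let v : R → ℕ∞ := fun z => if h : z = 0 then ⊤ else ((exists_order h).choose : ℕ∞)
  have hv0 : v 0 = ⊤ := by simp [v]
  have hv1 : ∀ z, z ≠ 0 → ∃ k : ℕ, v z = k ∧ z ∈ maximalIdeal R ^ k ∧
      z ∉ maximalIdeal R ^ (k + 1) := by
    intro z hz
    refine ⟨(exists_order hz).choose, by simp [v, hz], (exists_order hz).choose_spec⟩
  have hle : ∀ (n : ℕ) (z : R), (n : ℕ∞) ≤ v z ↔ z ∈ maximalIdeal R ^ n := by
    intro n z
    by_cases hz : z = 0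
    · rw [hz, hv0]; simp
    · obtain ⟨k, h1, h2, h3⟩ := hv1 z hz
      rw [h1, Nat.cast_le]
      constructor
      · intro h; exact Ideal.pow_le_pow_right h h2
      · intro h; by_contra hcon
        exact h3 (Ideal.pow_le_pow_right (by omega) h)
  have huniq : ∀ z (k : ℕ), z ∈ maximalIdeal R ^ k → z ∉ maximalIdeal R ^ (k + 1) → v z = k := by
    intro z k h1 h2
    apply le_antisymm
    · by_contra hcon
      apply h2
      rw [← hle]
      push_cast
      exact Order.add_one_le_of_lt (not_le.mp hcon)
    · exact (hle _ _).mpr h1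
  have hnt : ∀ z, z ≠ 0 → v z ≠ ⊤ := by
    intro z hz
    obtain ⟨k, h1, -⟩ := hv1 z hz
    rw [h1]; simp
  refine ⟨⟨v, hv0, ?_, ?_, ?_, ?_, ?_⟩, hle⟩
  · refine huniq 1 0 (by simp) ?_
    rw [zero_add, pow_one]
    exact (Ideal.ne_top_iff_one _).mp Ideal.IsPrime.ne_top'
  · intro a b
    by_cases ha : a = 0
    · rw [ha, zero_mul, hv0, top_add]
    by_cases hb : b = 0
    · rw [hb, mul_zero, hv0, add_top]
    obtain ⟨n, h1, h2, h3⟩ := hv1 a ha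
    obtain ⟨m, h4, h5, h6⟩ := hv1 b hb
    obtain ⟨h7, h8⟩ := c.order_mul h2 h3 h5 h6
    rw [huniq _ _ h7 h8, h1, h4]; push_cast; rfl
  · intro a b
    rw [← ENat.forall_natCast_le_iff_le]
    intro n hn
    rw [hle]
    exact Ideal.add_mem _ ((hle _ _).mp (hn.trans (min_le_left _ _)))
      ((hle _ _).mp (hn.trans (min_le_right _ _)))
  · intro z
    constructor
    · intro h; by_contra hz; exact hnt z hz h
    · rintro rfl; exact hv0
  · refine ⟨c.x, ?_, hnt _ c.x0⟩
    have : (1 : ℕ) ≤ v c.x := (hle 1 c.x).mpr (by rw [pow_one]; exact c.xM)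
    intro h
    rw [h] at this
    simp at this

theorem exists_generic {R S : Type*} [CommRing R] [IsLocalRing R]
    [CommRing S] [IsDomain S] [Algebra R S] (c : BChart R S) [Infinite (ResidueField R)]
    {ι : Type*} [Finite ι] (w : ι → DiscreteValuationOn R) {r : ℕ} {f : R}
    (hf : f ∈ maximalIdeal R ^ r) (hf' : f ∉ maximalIdeal R ^ (r + 1)) :
    ∃ x y e : R, maximalIdeal R = Ideal.span {x, y} ∧ (∀ i, (w i).v x ≤ (w i).v y) ∧
      IsUnit e ∧ f - e * y ^ r ∈ Ideal.span {x} := by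
  set a := c.y with ha
  set b := c.x with hb
  obtain ⟨s, ⟨F, hF, rfl⟩, hs⟩ := c.deg_of_mem_pow r hf
  have hF0 : F.map (residue R) ≠ 0 := by
    rw [c.mem_pow_succ r hf hs, c.hρ] at hf'
    exact hf'
  rw [← hom_spec c.hxt F r hF] at hs
  have hs := c.inj hs
  let bad : ι → Set (ResidueField R) := fun i => residue R '' {z | (w i).v b < (w i).v (a - z * b)}
  have hbad : ∀ i, (bad i).Finite := by
    intro i
    apply Set.Subsingleton.finite
    rintro _ ⟨z, hz, rfl⟩ _ ⟨z', hz', rfl⟩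
    by_contra hne
    have hu : IsUnit (z - z') := by
      rw [← residue_ne_zero_iff_isUnit, map_sub]
      exact sub_ne_zero.mpr hne
    have h1 := (w i).v_add (a - z' * b) (-(a - z * b))
    rw [(w i).v_neg] at h1
    have h2 : a - z' * b + -(a - z * b) = (z - z') * b := by ring
    rw [h2, (w i).v_mul, (w i).v_unit hu, zero_add] at h1
    exact absurd h1 (not_le.mpr (lt_min hz' hz))
  have hfin : ((⋃ i, bad i) ∪ {γ | (F.map (residue R)).IsRoot γ}).Finite :=
    (Set.finite_iUnion hbad).union (finite_setOfPred_isRoot hF0)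
  obtain ⟨γ, hγ⟩ := hfin.infinite_compl.nonempty
  obtain ⟨z, rfl⟩ := residue_surjective γ
  simp only [Set.mem_compl_iff, Set.mem_union, Set.mem_iUnion, Set.mem_ofPred_eq, not_or,
    not_exists] at hγ
  obtain ⟨h1, h2⟩ := hγ
  refine ⟨a - z * b, b, F.eval z, ?_, ?_, ?_, ?_⟩
  · rw [c.hM]
    apply le_antisymm
    · rw [Ideal.span_le]
      rintro q (rfl | rfl)
      · exact Ideal.subset_span (Or.inr rfl)
      · exact Ideal.mem_span_pair.mpr ⟨1, z, by ring⟩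
    · rw [Ideal.span_le]
      rintro q (rfl | rfl)
      · exact Ideal.mem_span_pair.mpr ⟨-z, 1, by ring⟩
      · exact Ideal.subset_span (Or.inl rfl)
  · intro i
    by_contra hcon
    exact h1 i ⟨z, not_le.mp hcon, rfl⟩
  · rw [← residue_ne_zero_iff_isUnit]
    intro h
    apply h2
    rw [IsRoot, eval_map, eval₂_at_apply, h]
  · rw [hs, eval_eq_sum_range' (n := r + 1) (by omega), Finset.sum_mul, ← Finset.sum_sub_distrib]
    refine Ideal.sum_mem _ fun i hi => ?_
    have hi' : i ≤ r := by simpa [Nat.lt_succ_iff] using hi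
    rw [Ideal.mem_span_singleton]
    have h3 : F.coeff i * (b ^ (r - i) * a ^ i) - F.coeff i * z ^ i * b ^ r =
        F.coeff i * b ^ (r - i) * (a ^ i - (z * b) ^ i) := by
      conv_lhs => rw [← Nat.sub_add_cancel hi', pow_add, Nat.add_sub_cancel]
      ring
    rw [h3]
    exact Dvd.dvd.mul_left (sub_dvd_pow_sub_pow _ _ _) _

theorem BChart.exists_monic {R S : Type*} [CommRing R] [IsLocalRing R]
    [CommRing S] [IsDomain S] [Algebra R S] (c : BChart R S) {r : ℕ} {f e : R}
    (hf : f ∈ maximalIdeal R ^ r) (he : IsUnit e) (h : f - e * c.y ^ r ∈ Ideal.span {c.x}) :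
    ∃ (A : R[X]) (v : R), A.Monic ∧ A.natDegree = r ∧
      algebraMap R S (v * f) = algebraMap R S c.x ^ r * aeval c.t A := by
  obtain ⟨s, ⟨F, hF, rfl⟩, hs⟩ := c.deg_of_mem_pow r hf
  have hs' := hs
  rw [← hom_spec c.hxt F r hF] at hs'
  have hs' := c.inj hs'
  rw [Finset.sum_range_succ] at hs'
  have h1 : ∑ i ∈ Finset.range r, F.coeff i * (c.x ^ (r - i) * c.y ^ i) ∈ Ideal.span {c.x} := by
    refine Ideal.sum_mem _ fun i hi => ?_
    have hi' : i < r := by simpa using hi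
    refine Ideal.mul_mem_left _ _ (Ideal.mul_mem_right _ _ ?_)
    exact Ideal.pow_mem_of_mem _ (Ideal.mem_span_singleton_self _) _ (by omega)
  have h2 : (e - F.coeff r) * c.y ^ r ∈ Ideal.span {c.x} := by
    have : (e - F.coeff r) * c.y ^ r =
      (∑ i ∈ Finset.range r, F.coeff i * (c.x ^ (r - i) * c.y ^ i)) - (f - e * c.y ^ r) := by
      rw [hs', Nat.sub_self, pow_zero]; ring
    rw [this]; exact Ideal.sub_mem _ h1 h
  have h3 : e - F.coeff r ∈ Ideal.span {c.x} := by
    rcases c.prime.mem_or_mem h2 with h3 | h3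
    · exact h3
    · exact absurd (c.prime.mem_of_pow_mem _ h3) c.ynot
  have h4 : IsUnit (F.coeff r) := by
    rw [← residue_ne_zero_iff_isUnit]
    rw [← residue_ne_zero_iff_isUnit] at he
    have : residue R (e - F.coeff r) = 0 := by
      rw [residue_eq_zero_iff]
      exact (Ideal.span_singleton_le_iff_mem _).mpr c.xM h3
    rw [map_sub, sub_eq_zero] at this
    rwa [← this]
  obtain ⟨v, hv⟩ := h4.exists_left_inv
  have hc : (C v * F).coeff r = 1 := by rw [coeff_C_mul, hv]
  have hd : (C v * F).natDegree ≤ r := (natDegree_C_mul_le _ _).trans hF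
  have hnd : (C v * F).natDegree = r := by
    refine le_antisymm hd (le_natDegree_of_ne_zero ?_)
    rw [hc]; exact one_ne_zero
  refine ⟨C v * F, v, ?_, hnd, ?_⟩
  · rw [Monic, leadingCoeff, hnd, hc]
  · rw [map_mul, hs, map_mul, aeval_C]; ring


theorem max_pow_eq_top {R : Type*} [CommRing R] [IsLocalRing R] {n : ℕ}
    (h : maximalIdeal R ^ n = ⊤) : n = 0 := by
  by_contra hn
  have h1 : maximalIdeal R ^ n ≤ maximalIdeal R := Ideal.pow_le_self hn
  rw [h] at h1
  exact (Ideal.IsPrime.ne_top' (I := maximalIdeal R)) (top_le_iff.mp h1)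

theorem max_pow_simple {R : Type*} [CommRing R] [IsLocalRing R] {n : ℕ}
    (h : (maximalIdeal R ^ n).IsSimpleIdeal) : n = 1 := by
  rcases n with _ | n
  · exact absurd (by simp) h.1
  · rcases h.2 _ _ (pow_succ _ _) with h1 | h1
    · rw [max_pow_eq_top h1]
    · exact absurd h1 Ideal.IsPrime.ne_top'

namespace BChart
variable {R S : Type*} [CommRing R] [IsLocalRing R] [CommRing S] [IsDomain S] [Algebra R S]
  (c : BChart R S)

theorem image_gen (J : Ideal S) (hJ : ∃ j ∈ J, c.ρ j ≠ 0) :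
    ∃ p : (ResidueField R)[X], p.Monic ∧ (∃ j ∈ J, c.ρ j = p) ∧ ∀ j ∈ J, p ∣ c.ρ j := by
  obtain ⟨q, hq⟩ := (IsPrincipalIdealRing.principal (J.map c.ρ)).principal
  rw [Ideal.submodule_span_eq] at hq
  have hq0 : q ≠ 0 := by
    rintro rfl
    obtain ⟨j, hj, h0⟩ := hJ
    have := Ideal.mem_map_of_mem c.ρ hj
    rw [hq, Ideal.mem_span_singleton, zero_dvd_iff] at this
    exact h0 this
  have hu : IsUnit (C (q.leadingCoeff⁻¹)) := by
    rw [isUnit_C, isUnit_iff_ne_zero]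
    exact inv_ne_zero (leadingCoeff_ne_zero.mpr hq0)
  have hq' : J.map c.ρ = Ideal.span {q * C (q.leadingCoeff⁻¹)} := by
    rw [hq, Ideal.span_singleton_mul_right_unit hu]
  refine ⟨q * C (q.leadingCoeff⁻¹), monic_mul_leadingCoeff_inv hq0, ?_, ?_⟩
  · have : q * C (q.leadingCoeff⁻¹) ∈ J.map c.ρ := by
      rw [hq']; exact Ideal.mem_span_singleton_self _
    obtain ⟨j, hj, h⟩ := (Ideal.mem_map_iff_of_surjective _ c.rho_surj).mp this
    exact ⟨j, hj, h⟩
  · intro j hj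
    rw [← Ideal.mem_span_singleton, ← hq']
    exact Ideal.mem_map_of_mem _ hj

theorem contr_eq_top {n : ℕ} {J : Ideal S} (h : c.contr n J = ⊤) : J = ⊤ ∧ n = 0 := by
  have h1 := c.contr_le n J
  rw [h, top_le_iff] at h1
  have h2 := max_pow_eq_top h1
  refine ⟨?_, h2⟩
  have h3 : (1 : R) ∈ c.contr n J := by rw [h]; trivial
  obtain ⟨s, hs, h⟩ := c.mem_contr.mp h3
  rw [h2, map_one, pow_zero, one_mul] at h
  rw [Ideal.eq_top_iff_one, h]; exact hs

theorem step_a {I : Ideal R} {I' : Ideal S} {e r : ℕ} (he : algebraMap R S c.x ^ e ∈ I')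
    (hI : c.contr r I' = I) (hs : I.IsSimpleIdeal) {A : R[X]} (hA : A.Monic)
    (hAr : A.natDegree = r) (hAI : aeval c.t A ∈ I') :
    I = maximalIdeal R ∨ (I'.IsSimpleIdeal ∧ ∀ j ∈ I', A.map (residue R) ∣ c.ρ j) := by
  have hAρ : c.ρ (aeval c.t A) ≠ 0 := by
    rw [c.hρ]; exact (hA.map _).ne_zero
  have gen : ∀ J : Ideal S, I' ≤ J → ∃ p : (ResidueField R)[X], p.Monic ∧
      (∃ j ∈ J, c.ρ j = p) ∧ (∀ j ∈ J, p ∣ c.ρ j) ∧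
      ∃ B : R[X], B.Monic ∧ B.natDegree = p.natDegree ∧ aeval c.t B ∈ J := by
    intro J hJ
    obtain ⟨p, h1, h2, h3⟩ := c.image_gen J ⟨_, hJ hAI, hAρ⟩
    exact ⟨p, h1, h2, h3, c.weierstrass J e (hJ he) h1 h2⟩
  obtain ⟨p, hp, hpm, hpd, B, hB, hBd, hBI⟩ := gen I' le_rfl
  have hpA : p ∣ A.map (residue R) := by rw [← c.hρ]; exact hpd _ hAI
  have hle : p.natDegree ≤ r := by
    have := natDegree_le_of_dvd hpA (hA.map _).ne_zero
    rwa [hA.natDegree_map, hAr] at this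
  have h1 := c.contr_mul (J := I') (K := ⊤) (r - p.natDegree) hB hBd monic_one natDegree_one hBI
    (by simp)
  rw [Ideal.mul_top, add_zero, Nat.sub_add_cancel hle, c.contr_top, pow_zero, Ideal.one_eq_top,
    Ideal.mul_top, hI] at h1
  by_cases hcase : p.natDegree = r
  · right
    have hpA' : p = A.map (residue R) := by
      symm; apply eq_of_monic_of_dvd_of_natDegree_le hp (hA.map _) hpA
      rw [hA.natDegree_map, hAr, hcase]
    rw [← hpA']
    refine ⟨⟨?_, ?_⟩, hpd⟩
    · rintro rfl
      have h2 := hpd 1 trivial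
      rw [map_one] at h2
      have h3 := hp.eq_one_of_isUnit (isUnit_of_dvd_one h2)
      rw [h3, natDegree_one] at hcase
      rw [← hcase, c.contr_top, pow_zero, Ideal.one_eq_top] at hI
      exact hs.1 hI.symm
    · intro J K hJK
      obtain ⟨p1, hp1, ⟨j1, hj1, hj1'⟩, hpd1, B1, hB1, hBd1, hBJ⟩ := gen J (hJK.le.trans Ideal.mul_le_left)
      obtain ⟨p2, hp2, ⟨j2, hj2, hj2'⟩, hpd2, B2, hB2, hBd2, hBK⟩ := gen K (hJK.le.trans Ideal.mul_le_right)
      have hdeg : p1.natDegree + p2.natDegree = r := by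
        rw [← hp1.natDegree_mul hp2]
        apply le_antisymm
        · have : p1 * p2 ∣ p := by
            obtain ⟨j, hj, rfl⟩ := hpm
            rw [hJK] at hj
            refine Submodule.mul_induction_on hj ?_ ?_
            · intro m hm n hn
              rw [map_mul]
              exact mul_dvd_mul (hpd1 m hm) (hpd2 n hn)
            · intro a b ha hb
              rw [map_add]; exact dvd_add ha hb
          have := natDegree_le_of_dvd this hp.ne_zero
          rwa [hcase] at this
        · have : p ∣ p1 * p2 := by
            rw [← hj1', ← hj2', ← map_mul]
            apply hpd
            rw [hJK]; exact Ideal.mul_mem_mul hj1 hj2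
          have := natDegree_le_of_dvd this (hp1.mul hp2).ne_zero
          rwa [hcase] at this
      have h2 := c.contr_mul (J := J) (K := K) 0 hB1 hBd1 hB2 hBd2 hBJ hBK
      rw [zero_add, hdeg, ← hJK, hI, pow_zero, Ideal.one_eq_top, Ideal.top_mul] at h2
      rcases hs.2 _ _ h2 with h3 | h3
      · exact Or.inl (c.contr_eq_top h3).1
      · exact Or.inr (c.contr_eq_top h3).1
  · left
    rcases hs.2 _ _ h1 with h2 | h2
    · have := max_pow_eq_top h2
      omega
    · rw [h2, Ideal.mul_top] at h1
      rw [h1] at hs ⊢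
      rw [max_pow_simple hs, pow_one]

theorem step_b [IsAlgClosed (ResidueField R)] {I' : Ideal S} {e r : ℕ}
    (he : algebraMap R S c.x ^ e ∈ I')
    (hs : I'.IsSimpleIdeal) {p : (ResidueField R)[X]} (hp : p.Monic) (hr : p.natDegree = r)
    (hr0 : r ≠ 0) (hpm : ∃ j ∈ I', c.ρ j = p) (hpd : ∀ j ∈ I', p ∣ c.ρ j) :
    ∃ α : ResidueField R, p = (X - C α) ^ r := by
  obtain ⟨α, hα⟩ := IsAlgClosed.exists_root p (by
    rw [degree_eq_natDegree hp.ne_zero, hr]; exact_mod_cast hr0)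
  refine ⟨α, ?_⟩
  obtain ⟨q, hq, hqd⟩ := exists_eq_pow_rootMultiplicity_mul_and_not_dvd p hp.ne_zero α
  set m := rootMultiplicity α p
  have hXm : ((X - C α) ^ m).Monic := (monic_X_sub_C α).pow m
  have hqm : q.Monic := hXm.of_mul_monic_left (hq ▸ hp)
  by_cases hq1 : q = 1
  · rw [hq1, mul_one] at hq
    have : r = m := by rw [← hr, hq, natDegree_pow, natDegree_X_sub_C, mul_one]
    rw [this, ← hq]
  · exfalso
    have hcop : IsCoprime (X - C α) q :=
      ((irreducible_X_sub_C α).coprime_iff_not_dvd).mpr hqd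
    have hm0 : m ≠ 0 := by
      have := (rootMultiplicity_pos hp.ne_zero).mpr hα
      exact this.ne'
    obtain ⟨P1, hP1⟩ := c.rho_surj ((X - C α) ^ m)
    obtain ⟨P2, hP2⟩ := c.rho_surj q
    obtain ⟨j0, hj0, hj0'⟩ := hpm
    have hcop2 : IsCoprime ((X - C α) ^ m) q := hcop.pow_left
    set ξ := algebraMap R S c.x with hξ
    -- `P1 * P2` is in the radical
    have h12 : (P1 * P2) ^ e ∈ I' := by
      have h1 : ξ ∣ P1 * P2 - j0 := by
        rw [← c.rho_eq_zero, map_sub, map_mul, hP1, hP2, hj0', hq, sub_self]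
      obtain ⟨s, hs⟩ := h1
      have h2 : P1 * P2 = ξ * s + j0 := by rw [← hs]; ring
      rw [h2]
      have h3 : j0 ∣ (ξ * s + j0) ^ e - (ξ * s) ^ e := by
        have := sub_dvd_pow_sub_pow (ξ * s + j0) (ξ * s) e
        rwa [add_sub_cancel_left] at this
      have h4 : (ξ * s) ^ e ∈ I' := by rw [mul_pow]; exact I'.mul_mem_right _ he
      have h5 := I'.add_mem (I'.mem_of_dvd h3 hj0) h4
      rwa [sub_add_cancel] at h5
    let J := I' ⊔ Ideal.span {P1 ^ e}
    let K := I' ⊔ Ideal.span {P2 ^ e}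
    have hIJ : I' ≤ J := le_sup_left
    have hIK : I' ≤ K := le_sup_left
    have hcopJK : J ⊔ K = ⊤ := by
      rw [← Ideal.radical_eq_top, Ideal.eq_top_iff_one]
      obtain ⟨u, v, huv⟩ := hcop2
      obtain ⟨u, rfl⟩ := c.rho_surj u
      obtain ⟨v, rfl⟩ := c.rho_surj v
      have h1 : ξ ∣ 1 - (u * P1 + v * P2) := by
        rw [← c.rho_eq_zero, map_sub, map_add, map_mul, map_mul, hP1, hP2, huv, map_one, sub_self]
      have h2 : ξ ∈ (J ⊔ K).radical := ⟨e, (hIJ.trans le_sup_left) he⟩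
      have h3 : P1 ∈ (J ⊔ K).radical :=
        ⟨e, (le_sup_right.trans le_sup_left : Ideal.span {P1 ^ e} ≤ J ⊔ K)
          (Ideal.mem_span_singleton_self _)⟩
      have h4 : P2 ∈ (J ⊔ K).radical :=
        ⟨e, (le_sup_right.trans le_sup_right : Ideal.span {P2 ^ e} ≤ J ⊔ K)
          (Ideal.mem_span_singleton_self _)⟩
      have h5 := Ideal.add_mem _ (Ideal.mem_of_dvd _ h1 h2)
        (Ideal.add_mem _ (Ideal.mul_mem_left _ u h3) (Ideal.mul_mem_left _ v h4))
      rwa [sub_add_cancel] at h5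
    have hprod : I' = J * K := by
      apply le_antisymm
      · rw [Ideal.mul_eq_inf_of_coprime hcopJK]
        exact le_inf hIJ hIK
      · simp only [J, K]
        rw [Ideal.sup_mul]
        refine sup_le Ideal.mul_le_left ?_
        rw [Ideal.mul_sup]
        refine sup_le Ideal.mul_le_right ?_
        rw [Ideal.span_singleton_mul_span_singleton, ← mul_pow, Ideal.span_singleton_le_iff_mem]
        exact h12
    have hunit : ∀ (P g : S) (g' : (ResidueField R)[X]), g' ∣ p → c.ρ P = g' →
        I' ⊔ Ideal.span {P ^ e} = ⊤ → IsUnit (c.ρ P) := by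
      intro P g g' hg' hP htop
      rw [Ideal.eq_top_iff_one] at htop
      obtain ⟨a, ha, b, hb, hab⟩ := Submodule.mem_sup.mp htop
      rw [Ideal.mem_span_singleton] at hb
      have he0 : e ≠ 0 := by
        rintro rfl
        rw [pow_zero] at he
        exact hs.1 ((Ideal.eq_top_iff_one _).mpr he)
      apply isUnit_of_dvd_one
      rw [← map_one c.ρ, ← hab, map_add]
      refine dvd_add ?_ ?_
      · rw [hP]; exact hg'.trans (hpd a ha)
      · exact (map_dvd c.ρ ((dvd_pow_self P he0).trans hb))
    rcases hs.2 _ _ hprod with h | h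
    · have := hunit P1 P1 _ ⟨q, hq⟩ hP1 h
      rw [hP1] at this
      have h2 := hXm.eq_one_of_isUnit this
      have h3 := congrArg natDegree h2
      rw [natDegree_pow, natDegree_X_sub_C, natDegree_one, mul_one] at h3
      exact hm0 h3
    · have := hunit P2 P2 _ ⟨_, hq.trans (mul_comm _ _)⟩ hP2 h
      rw [hP2] at this
      exact hq1 (hqm.eq_one_of_isUnit this)

end BChart

section loc
variable {S : Type u} [CommRing S] (N : Ideal S) [hN : N.IsMaximal]

theorem loc_contract {J : Ideal S} {m : ℕ} (hJ : N ^ m ≤ J) {s : S}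
    (hs : algebraMap S (Localization.AtPrime N) s ∈ J.map (algebraMap S (Localization.AtPrime N))) :
    s ∈ J := by
  rw [IsLocalization.algebraMap_mem_map_algebraMap_iff N.primeCompl] at hs
  obtain ⟨u, hu, hus⟩ := hs
  have hu' : u ∉ N := hu
  have h1 : Ideal.span {u} ⊔ N = ⊤ := by
    by_contra h
    have h3 := hN.eq_of_le h le_sup_right
    apply hu'
    rw [h3]
    exact (le_sup_left : Ideal.span {u} ≤ _) (Ideal.mem_span_singleton_self _)
  have h2 : Ideal.span {u} ⊔ N ^ m = ⊤ := by
    exact Ideal.sup_pow_eq_top h1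
  rw [Ideal.eq_top_iff_one] at h2
  obtain ⟨a, ha, b, hb, hab⟩ := Submodule.mem_sup.mp h2
  obtain ⟨a', rfl⟩ := Ideal.mem_span_singleton.mp ha
  have : s = a' * (u * s) + b * s := by
    calc s = 1 * s := (one_mul s).symm
      _ = _ := by rw [← hab]; ring
  rw [this]
  exact J.add_mem (J.mul_mem_left _ hus) (J.mul_mem_right _ (hJ hb))

theorem loc_simple {I : Ideal S} {m : ℕ} (hI : N ^ m ≤ I) (hs : I.IsSimpleIdeal) :
    (I.map (algebraMap S (Localization.AtPrime N))).IsSimpleIdeal := by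
  constructor
  · intro h
    apply hs.1
    rw [Ideal.eq_top_iff_one]
    apply loc_contract N hI
    rw [h]; trivial
  · intro J K hJK
    set φ := algebraMap S (Localization.AtPrime N)
    have hJ : (J.comap φ).map φ = J := IsLocalization.map_under N.primeCompl (Localization.AtPrime N) J
    have hK : (K.comap φ).map φ = K := IsLocalization.map_under N.primeCompl (Localization.AtPrime N) K
    have hIJ : I ≤ J.comap φ := by
      rw [← Ideal.map_le_iff_le_comap, hJK]; exact Ideal.mul_le_left
    have hIK : I ≤ K.comap φ := by
      rw [← Ideal.map_le_iff_le_comap, hJK]; exact Ideal.mul_le_right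
    have hmap : (J.comap φ * K.comap φ).map φ = I.map φ := by
      rw [Ideal.map_mul, hJ, hK, hJK]
    have hp : I = J.comap φ * K.comap φ := by
      apply le_antisymm
      · intro s hs
        apply loc_contract N (m := m + m)
        · rw [pow_add]; exact Ideal.mul_mono (hI.trans hIJ) (hI.trans hIK)
        · rw [hmap]; exact Ideal.mem_map_of_mem _ hs
      · intro s hs
        apply loc_contract N hI
        rw [← hmap]; exact Ideal.mem_map_of_mem _ hs
    rcases hs.2 _ _ hp with h | h
    · left; rw [← hJ, h, Ideal.map_top]
    · right; rw [← hK, h, Ideal.map_top]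

theorem loc_val [IsDomain S] (w : DiscreteValuationOn S) (hw : ∀ s, s ∉ N → w.v s = 0) :
    ∃ w' : DiscreteValuationOn (Localization.AtPrime N),
      ∀ a, w'.v (algebraMap S (Localization.AtPrime N) a) = w.v a := by
  have : IsDomain (Localization.AtPrime N) :=
    IsLocalization.isDomain_localization N.primeCompl_le_nonZeroDivisors
  apply exists_extension _ (IsLocalization.injective _ N.primeCompl_le_nonZeroDivisors)
  intro s
  obtain ⟨a, b, rfl⟩ := IsLocalization.exists_mk'_eq N.primeCompl s
  refine ⟨a, b, ?_, ?_, ?_⟩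
  · intro h; exact b.2 (by rw [h]; exact N.zero_mem)
  · exact IsLocalization.mk'_spec' _ a b
  · rw [hw _ b.2]; exact zero_le

theorem loc_dim [IsDomain S] {ξ τ : S} (hNs : N = Ideal.span {ξ, τ})
    (hξ : (Ideal.span {ξ}).IsPrime) (hξ0 : ξ ≠ 0) (hτ : τ ∉ Ideal.span {ξ}) :
    2 ≤ ringKrullDim (Localization.AtPrime N) ∧
    maximalIdeal (Localization.AtPrime N) = Ideal.span
      {algebraMap S (Localization.AtPrime N) ξ, algebraMap S (Localization.AtPrime N) τ} := by
  have : IsDomain (Localization.AtPrime N) :=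
    IsLocalization.isDomain_localization N.primeCompl_le_nonZeroDivisors
  have hinj : Function.Injective (algebraMap S (Localization.AtPrime N)) :=
    (IsLocalization.injective _ N.primeCompl_le_nonZeroDivisors)
  have hmax : maximalIdeal (Localization.AtPrime N) = Ideal.span
      {algebraMap S (Localization.AtPrime N) ξ, algebraMap S (Localization.AtPrime N) τ} := by
    rw [← Localization.AtPrime.map_eq_maximalIdeal]
    have h := congrArg (Ideal.map (algebraMap S (Localization.AtPrime N))) hNs
    rw [h, Ideal.map_span, Set.image_pair]
  refine ⟨?_, hmax⟩
  have hle : Ideal.span {ξ} ≤ N := by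
    rw [hNs]; exact Ideal.span_mono (by simp)
  have hdis : Disjoint (N.primeCompl : Set S) (Ideal.span {ξ} : Ideal S) := by
    rw [Set.disjoint_left]
    intro a ha ha'
    exact ha (hle ha')
  have hP := IsLocalization.isPrime_of_isPrime_disjoint N.primeCompl (Localization.AtPrime N)
    _ hξ hdis
  have hc := IsLocalization.under_map_of_isPrime_disjoint N.primeCompl (Localization.AtPrime N)
    hξ hdis
  let p0 : PrimeSpectrum (Localization.AtPrime N) := ⟨⊥, Ideal.isPrime_bot⟩
  let p1 : PrimeSpectrum (Localization.AtPrime N) := ⟨_, hP⟩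
  let p2 : PrimeSpectrum (Localization.AtPrime N) := ⟨maximalIdeal _, inferInstance⟩
  have h01 : p0 < p1 := by
    rw [← PrimeSpectrum.asIdeal_lt_asIdeal]
    apply bot_lt_iff_ne_bot.mpr
    intro h
    have h2 : algebraMap S (Localization.AtPrime N) ξ ∈
      (Ideal.span {ξ}).map (algebraMap S (Localization.AtPrime N)) :=
      Ideal.mem_map_of_mem _ (Ideal.mem_span_singleton_self _)
    have h3 : algebraMap S (Localization.AtPrime N) ξ = 0 := by
      rw [← Ideal.mem_bot, ← h]; exact h2
    exact hξ0 (hinj (by rw [h3, map_zero]))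
  have h12 : p1 < p2 := by
    rw [← PrimeSpectrum.asIdeal_lt_asIdeal]
    refine lt_of_le_of_ne (le_maximalIdeal hP.ne_top) ?_
    intro h
    apply hτ
    rw [← hc, Ideal.mem_comap]
    have : algebraMap S (Localization.AtPrime N) τ ∈ maximalIdeal (Localization.AtPrime N) := by
      rw [hmax]; exact Ideal.subset_span (by simp)
    rw [← (show _ = maximalIdeal _ from h)] at this
    exact this
  let l : LTSeries (PrimeSpectrum (Localization.AtPrime N)) :=
    ⟨2, ![p0, p1, p2], by intro i; fin_cases i; exacts [h01, h12]⟩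
  exact Order.LTSeries.length_le_krullDim l

theorem loc_algClosed {k : Type u} [Field k] [IsAlgClosed k] (f : S →+* k)
    (hf : Function.Surjective f) (hk : RingHom.ker f = N) :
    IsAlgClosed (ResidueField (Localization.AtPrime N)) := by
  subst hk
  let e1 := RingHom.quotientKerEquivOfSurjective hf
  let e2 : S ⧸ RingHom.ker f ≃+* ResidueField (Localization.AtPrime (RingHom.ker f)) :=
    IsLocalization.AtPrime.equivQuotMaximalIdeal (RingHom.ker f) (Localization.AtPrime (RingHom.ker f))
  exact IsAlgClosed.of_ringEquiv k _ (e1.symm.trans e2)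

end loc


theorem exists_restrict {A B : Type*} [CommRing A] [CommRing B]
    (φ : A →+* B) (hφ : Function.Injective φ) (w : DiscreteValuationOn B)
    (h : ∃ a, a ≠ 0 ∧ w.v (φ a) ≠ 0) :
    ∃ w' : DiscreteValuationOn A, ∀ a, w'.v a = w.v (φ a) := by
  refine ⟨⟨fun a => w.v (φ a), ?_, ?_, ?_, ?_, ?_, ?_⟩, fun a => rfl⟩
  · rw [map_zero, w.v_zero]
  · rw [map_one, w.v_one]
  · intro a b; rw [map_mul, w.v_mul]
  · intro a b; rw [map_add]; exact w.v_add _ _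
  · intro a; rw [w.v_top_iff, map_eq_zero_iff φ hφ]
  · obtain ⟨a, ha, h1⟩ := h
    exact ⟨a, h1, w.ne_top (by rwa [Ne, map_eq_zero_iff φ hφ])⟩

namespace BChart
variable {R S : Type*} [CommRing R] [IsLocalRing R] [CommRing S] [IsDomain S] [Algebra R S]
  (c : BChart R S)

theorem exists_val (w : DiscreteValuationOn R) (h : w.v c.x ≤ w.v c.y) :
    ∃ w' : DiscreteValuationOn S, ∀ a, w'.v (algebraMap R S a) = w.v a := by
  have := w.isDomain
  apply exists_extension _ c.inj
  intro s
  obtain ⟨n, hn⟩ := c.exists_deg s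
  obtain ⟨z, hz⟩ := (c.deg_iff n s).mp hn
  refine ⟨z, c.x ^ n, pow_ne_zero _ c.x0, by rw [map_pow, hz], ?_⟩
  have hzM := c.mem_pow_of_deg n hn hz
  have key : ∀ n : ℕ, maximalIdeal R ^ n ≤ w.vIdeal (w.v (c.x ^ n)) := by
    intro n
    induction n with
    | zero => intro a _; rw [w.mem_vIdeal, pow_zero, w.v_one]; exact zero_le
    | succ n ih =>
      rw [pow_succ, pow_succ, Ideal.mul_le, w.v_mul]
      intro a ha b hb
      rw [w.mem_vIdeal, w.v_mul]
      apply add_le_add (ih ha)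
      have h2 : maximalIdeal R ≤ w.vIdeal (w.v c.x) := by
        rw [c.hM, Ideal.span_le]
        rintro q (rfl | rfl)
        · exact le_refl (w.v c.x)
        · exact h
      exact h2 hb
  exact key n hzM

theorem point (α : ResidueField R) : ∃ τ : S,
    RingHom.ker ((evalRingHom α).comp c.ρ) = Ideal.span {algebraMap R S c.x, τ} ∧
    (Ideal.span {algebraMap R S c.x}).IsPrime ∧ τ ∉ Ideal.span {algebraMap R S c.x} ∧
    c.ρ τ = X - C α ∧ Function.Surjective ((evalRingHom α).comp c.ρ) := by
  obtain ⟨τ, hτ⟩ := c.rho_surj (X - C α)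
  refine ⟨τ, ?_, ?_, ?_, hτ, ?_⟩
  · apply le_antisymm
    · intro s hs
      rw [RingHom.mem_ker, RingHom.comp_apply, coe_evalRingHom] at hs
      obtain ⟨q, hq⟩ := dvd_iff_isRoot.mpr hs
      obtain ⟨q, rfl⟩ := c.rho_surj q
      have : c.ρ (s - τ * q) = 0 := by rw [map_sub, map_mul, hq, hτ, sub_self]
      obtain ⟨g, hg⟩ := c.rho_eq_zero.mp this
      rw [Ideal.mem_span_pair]
      exact ⟨g, q, by linear_combination -hg⟩
    · rw [Ideal.span_le]
      rintro q (rfl | rfl)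
      · simp [RingHom.mem_ker, c.rho_x]
      · simp [RingHom.mem_ker, hτ]
  · have : Ideal.span {algebraMap R S c.x} = RingHom.ker c.ρ := by
      ext s
      rw [Ideal.mem_span_singleton, RingHom.mem_ker, c.rho_eq_zero]
    rw [this]
    exact RingHom.ker_isPrime _
  · rw [Ideal.mem_span_singleton, ← c.rho_eq_zero, hτ]
    exact X_sub_C_ne_zero α
  · intro a
    obtain ⟨s, hs⟩ := c.rho_surj (C a)
    exact ⟨s, by simp [hs]⟩

theorem step_d [IsNoetherianRing R] {I : Ideal R} {I' : Ideal S} {e r : ℕ}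
    (he : algebraMap R S c.x ^ e ∈ I')
    (hI : c.contr r I' = I) {A : R[X]} (hA : A.Monic)
    (hAr : A.natDegree = r) (hAI : aeval c.t A ∈ I')
    (hd : ∀ j ∈ I', A.map (residue R) ∣ c.ρ j)
    (w : DiscreteValuationOn S) {N : ℕ} (hN : 0 < N)
    (hw : ∀ (m : ℕ) (s : S), s ∈ I' ^ m ↔ ((m * N : ℕ) : ℕ∞) ≤ w.v s) :
    ∃ (w : DiscreteValuationOn R) (N : ℕ), 0 < N ∧
      ∀ (m : ℕ) (z : R), z ∈ I ^ m ↔ ((m * N : ℕ) : ℕ∞) ≤ w.v z := by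
  have hx1 : w.v (algebraMap R S c.x) ≠ 0 := by
    intro h
    have := (hw 1 (algebraMap R S c.x ^ e)).mp (by rwa [pow_one])
    rw [w.v_pow, h, mul_zero] at this
    simp at this
    omega
  obtain ⟨w1, hw1⟩ := exists_restrict (algebraMap R S) c.inj w ⟨c.x, c.x0, hx1⟩
  obtain ⟨ξ, hξ⟩ := ENat.ne_top_iff_exists.mp (w.ne_top c.phx0)
  refine ⟨w1, r * ξ + N, by omega, fun m z => ?_⟩
  rw [← hI, ← c.contr_pow hA hAr hAI, c.mem_contr, hw1]
  constructor
  · rintro ⟨s, hs, h⟩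
    rw [h, w.v_mul, w.v_pow, ← hξ]
    have := (hw m s).mp hs
    calc ((m * (r * ξ + N) : ℕ) : ℕ∞) = ((m * r : ℕ) : ℕ∞) * ξ + ((m * N : ℕ) : ℕ∞) := by
          push_cast; ring
      _ ≤ _ := by gcongr
  · intro h
    by_cases hz : z = 0
    · exact ⟨0, Ideal.zero_mem _, by simp [hz]⟩
    obtain ⟨n, hn1, hn2⟩ := exists_order hz
    obtain ⟨s, hsd, hs⟩ := c.deg_of_mem_pow n hn1
    rw [c.mem_pow_succ n hn1 hs] at hn2
    have hs0 : s ≠ 0 := by rintro rfl; exact hn2 (map_zero _)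
    obtain ⟨d, hdv⟩ := ENat.ne_top_iff_exists.mp (w.ne_top hs0)
    have h1 : s ^ N ∈ I' ^ d := by
      rw [hw, w.v_pow, ← hdv]
      rw [← Nat.cast_mul, mul_comm]
    have h2 : (A.map (residue R)) ^ d ∣ c.ρ s ^ N := by
      rw [← map_pow, ← Ideal.mem_span_singleton, ← Ideal.span_singleton_pow, ← Ideal.mem_comap]
      refine Ideal.le_comap_pow _ d (Ideal.pow_right_mono ?_ d h1)
      intro j hj
      rw [Ideal.mem_comap, Ideal.mem_span_singleton]
      exact hd j hj
    have h3 : d * r ≤ N * n := by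
      have := natDegree_le_of_dvd h2 (pow_ne_zero _ hn2)
      rw [natDegree_pow, natDegree_pow, hA.natDegree_map, hAr] at this
      exact this.trans (Nat.mul_le_mul_left _ (c.rho_natDegree_le hsd))
    rw [hs, w.v_mul, w.v_pow, ← hξ, ← hdv] at h
    have h' : m * (r * ξ + N) ≤ n * ξ + d := by exact_mod_cast h
    have h4 : m * r ≤ n := by
      by_contra hcon
      push Not at hcon
      have h5 : n * ξ ≤ m * r * ξ := Nat.mul_le_mul_right _ hcon.le
      have h6 : m * N ≤ d := by nlinarith
      have h7 : m * N * r ≤ N * n := (Nat.mul_le_mul_right r h6).trans h3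
      nlinarith
    obtain ⟨q, rfl⟩ := Nat.exists_eq_add_of_le h4
    refine ⟨algebraMap R S c.x ^ q * s, ?_, by rw [hs]; ring⟩
    rw [hw, w.v_mul, w.v_pow, ← hξ, ← hdv]
    have : m * N ≤ q * ξ + d := by nlinarith
    exact_mod_cast this

end BChart

theorem main_ind (k : ℕ) : ∀ (R : Type u) [CommRing R] [IsLocalRing R] [IsNoetherianRing R]
    [IsDomain R] [IsAlgClosed (ResidueField R)], 2 ≤ ringKrullDim R →
    (∃ x y : R, maximalIdeal R = Ideal.span {x, y}) →
    ∀ (ι : Type u) [Finite ι] (w : ι → DiscreteValuationOn R) (n : ι → ℕ), (∀ i, 0 < n i) →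
    (∀ i, n i ≤ k) → ∀ I : Ideal R, (∀ z, z ∈ I ↔ ∀ i, (n i : ℕ∞) ≤ (w i).v z) →
    (∃ e, maximalIdeal R ^ e ≤ I) → I.IsSimpleIdeal →
    ∃ (w : DiscreteValuationOn R) (N : ℕ), 0 < N ∧
      ∀ (m : ℕ) (z : R), z ∈ I ^ m ↔ ((m * N : ℕ) : ℕ∞) ≤ w.v z := by
  induction k with
  | zero =>
    intro R _ _ _ _ _ hd hM ι _ w n hn0 hnk I hI he hs
    exfalso
    apply hs.1
    rw [Ideal.eq_top_iff_one, hI]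
    intro i
    have := hn0 i
    have := hnk i
    omega
  | succ k ih =>
    intro R _ _ _ _ _ hd hM ι _ w n hn0 hnk I hI he hs
    obtain ⟨e, he⟩ := he
    obtain ⟨x0, y0, hM⟩ := hM
    obtain ⟨S0, _, _, _, _, c0, -, -⟩ := exists_chart hd hM
    have hex : ∃ j, ¬ I ≤ maximalIdeal R ^ j := by
      have h0 : c0.x ^ e ≠ 0 := pow_ne_zero _ c0.x0
      obtain ⟨j, -, hj⟩ := exists_order h0
      exact ⟨j + 1, fun h => hj (h (he (Ideal.pow_mem_pow c0.xM e)))⟩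
    obtain ⟨r, hr1, hr2⟩ : ∃ r, I ≤ maximalIdeal R ^ r ∧ ¬ I ≤ maximalIdeal R ^ (r + 1) := by
      classical
      have h1 := Nat.find_spec hex
      have h2 := fun m => @Nat.find_min _ _ hex m
      set n := Nat.find hex
      rcases n with _ | n
      · simp at h1
      · exact ⟨n, not_not.mp (h2 n (by omega)), h1⟩
    have hr0 : r ≠ 0 := by
      rintro rfl
      rw [zero_add, pow_one] at hr2
      exact hr2 (le_maximalIdeal hs.1)
    obtain ⟨f, hfI, hf⟩ := Set.not_subset.mp hr2
    have hfI : f ∈ I := hfI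
    have hf : f ∉ maximalIdeal R ^ (r + 1) := hf
    have : Infinite (ResidueField R) := IsAlgClosed.instInfinite
    obtain ⟨x, y, u, hM, hwxy, hu, hfu⟩ := exists_generic c0 w (hr1 hfI) hf
    obtain ⟨S, _, _, _, _, c, rfl, rfl⟩ := exists_chart hd hM
    obtain ⟨A, v, hA, hAr, hAf⟩ := c.exists_monic (hr1 hfI) hu hfu
    choose w1 hw1 using fun i => c.exists_val (w i) (hwxy i)
    choose ξ hξ using fun i => ENat.ne_top_iff_exists.mp ((w i).ne_top c.x0)
    set n' : ι → ℕ := fun i => n i - r * ξ i with hn'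
    set I' : Ideal S := ⨅ i, (w1 i).vIdeal (n' i) with hI'
    have hmemI' : ∀ s, s ∈ I' ↔ ∀ i, (n' i : ℕ∞) ≤ (w1 i).v s := by
      intro s; simp only [hI', Ideal.mem_iInf, DiscreteValuationOn.mem_vIdeal]
    have hmem2 : ∀ s, s ∈ I' ↔ ∀ i, (n i : ℕ∞) ≤ (w1 i).v (algebraMap R S c.x ^ r * s) := by
      intro s
      rw [hmemI']
      refine forall_congr' fun i => ?_
      rw [(w1 i).v_mul, (w1 i).v_pow, hw1, ← hξ, hn']
      push_cast
      exact tsub_le_iff_left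
    have hcontr : c.contr r I' = I := by
      ext z
      rw [c.mem_contr, hI]
      constructor
      · rintro ⟨s, hs, h⟩ i
        rw [← hw1, h]
        exact (hmem2 s).mp hs i
      · intro hz
        obtain ⟨s, -, h⟩ := c.deg_of_mem_pow r (hr1 ((hI z).mpr hz))
        refine ⟨s, ?_, h⟩
        rw [hmem2]
        intro i
        rw [← h, hw1]
        exact hz i
    have hxe : c.x ^ e ∈ I := he (Ideal.pow_mem_pow c.xM e)
    have hxe' : algebraMap R S c.x ^ e ∈ I' := by
      rw [hmem2]
      intro i
      rw [(w1 i).v_mul, ← map_pow _ _ e, hw1]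
      exact ((hI _).mp hxe i).trans le_add_self
    have hAI : aeval c.t A ∈ I' := by
      rw [hmem2]
      intro i
      rw [← hAf, hw1]
      exact (hI _).mp (I.mul_mem_left _ hfI) i
    rcases c.step_a hxe' hcontr hs hA hAr hAI with hIM | ⟨hs', hdvd⟩
    · obtain ⟨w, hw⟩ := c.exists_ord
      refine ⟨w, 1, one_pos, fun m z => ?_⟩
      rw [mul_one, hw, hIM]
    · obtain ⟨α, hα⟩ := c.step_b hxe' hs' (hA.map (residue R)) (hA.natDegree_map _) (by rwa [hAr])
        ⟨_, hAI, c.hρ A⟩ hdvd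
      rw [hAr] at hα
      obtain ⟨τ, hNs, hprime, hτ, hρτ, hsurj⟩ := c.point α
      set N := RingHom.ker ((evalRingHom α).comp c.ρ) with hNdef
      have hNmax : N.IsMaximal := RingHom.ker_isMaximal_of_surjective _ hsurj
      have hrad : N ≤ I'.radical := by
        have h1 : algebraMap R S c.x ∈ I'.radical := ⟨e, hxe'⟩
        rw [hNs, Ideal.span_le]
        rintro q (rfl | rfl)
        · exact h1
        · have h2 : c.ρ (q ^ r - aeval c.t A) = 0 := by
            rw [map_sub, map_pow, hρτ, c.hρ, hα, sub_self]
          rw [c.rho_eq_zero] at h2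
          have h3 := Ideal.mem_of_dvd _ h2 h1
          have h4 := Ideal.add_mem _ h3 (Ideal.le_radical hAI)
          rw [sub_add_cancel] at h4
          have h5 : q ∈ I'.radical.radical := ⟨r, h4⟩
          rwa [Ideal.radical_idem] at h5
      obtain ⟨m0, hm0⟩ := Ideal.exists_pow_le_of_le_radical_of_fg hrad
        (IsNoetherian.noetherian N)
      obtain ⟨hd', hM'⟩ := loc_dim N hNs hprime c.phx0 hτ
      have hac := loc_algClosed N _ hsurj rfl
      have hs'' := loc_simple N hm0 hs'
      have hdom : IsDomain (Localization.AtPrime N) :=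
        IsLocalization.isDomain_localization N.primeCompl_le_nonZeroDivisors
      have hnoeth : IsNoetherianRing (Localization.AtPrime N) :=
        IsLocalization.isNoetherianRing N.primeCompl _ inferInstance
      have hval : ∀ i : {i // 0 < n' i}, ∃ w' : DiscreteValuationOn (Localization.AtPrime N),
          ∀ a, w'.v (algebraMap S (Localization.AtPrime N) a) = (w1 i).v a := by
        rintro ⟨i, hi⟩
        apply loc_val
        intro s hsN
        by_contra hs0
        have h1 : (1 : ℕ∞) ≤ (w1 i).v s := Order.one_le_iff_ne_zero.mpr hs0
        have h2 : N ≤ (w1 i).vIdeal 1 := by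
          intro b hb
          rw [DiscreteValuationOn.mem_vIdeal, Order.one_le_iff_ne_zero]
          intro hb0
          have h3 := (hmemI' _).mp (hm0 (Ideal.pow_mem_pow hb m0)) i
          rw [(w1 i).v_pow, hb0, mul_zero] at h3
          simp at h3
          omega
        have h3 : N = (w1 i).vIdeal 1 := by
          apply hNmax.eq_of_le ?_ h2
          rw [Ne, Ideal.eq_top_iff_one, DiscreteValuationOn.mem_vIdeal, (w1 i).v_one]
          simp
        exact hsN (h3 ▸ h1)
      choose w2 hw2 using hval
      have hξ1 : ∀ i, 1 ≤ ξ i := by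
        intro i
        by_contra hcon
        have h0 : ξ i = 0 := by omega
        have h1 := (hI _).mp hxe i
        rw [(w i).v_pow, ← hξ, h0] at h1
        simp at h1
        have := hn0 i
        omega
      obtain ⟨w3, N3, hN3, hw3⟩ := ih (Localization.AtPrime N) hd' ⟨_, _, hM'⟩ {i // 0 < n' i} w2
        (fun i => n' i) (fun i => i.2)
        (by
          rintro ⟨i, hi⟩
          have h1 := hξ1 i
          have h2 := hnk i
          have h3 : 1 ≤ r * ξ i := Nat.mul_pos (by omega) h1
          simp only [hn']
          omega)
        (I'.map (algebraMap S (Localization.AtPrime N)))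
        (by
          intro z
          obtain ⟨a, b, rfl⟩ := IsLocalization.exists_mk'_eq N.primeCompl z
          have hb : IsUnit (algebraMap S (Localization.AtPrime N) b) :=
            IsLocalization.map_units _ b
          have hz := IsLocalization.mk'_spec' (Localization.AtPrime N) a b
          set z := IsLocalization.mk' (Localization.AtPrime N) a b
          have h1 : z ∈ I'.map (algebraMap S (Localization.AtPrime N)) ↔ a ∈ I' := by
            rw [← Ideal.unit_mul_mem_iff_mem _ hb, hz]
            exact ⟨fun h => loc_contract N hm0 h, fun h => Ideal.mem_map_of_mem _ h⟩
          have h2 : ∀ i, (w2 i).v z = (w1 i).v a := by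
            intro i
            rw [← hw2, ← hz, (w2 i).v_mul, (w2 i).v_unit hb, zero_add]
          rw [h1, hmemI']
          constructor
          · intro h i; rw [h2]; exact h i
          · intro h i
            by_cases hi : 0 < n' i
            · rw [← h2 ⟨i, hi⟩]; exact h ⟨i, hi⟩
            · have : n' i = 0 := by omega
              rw [this]; simp)
        ⟨m0, by
          rw [← Localization.AtPrime.map_eq_maximalIdeal, ← Ideal.map_pow]
          exact Ideal.map_mono hm0⟩
        hs''
      have hinj : Function.Injective (algebraMap S (Localization.AtPrime N)) :=
        (IsLocalization.injective _ N.primeCompl_le_nonZeroDivisors)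
      have hw4 : ∀ (m : ℕ) (s : S), s ∈ I' ^ m ↔
          ((m * N3 : ℕ) : ℕ∞) ≤ w3.v (algebraMap S (Localization.AtPrime N) s) := by
        intro m s
        rw [← hw3, ← Ideal.map_pow]
        refine ⟨fun h => Ideal.mem_map_of_mem _ h, fun h => loc_contract N (m := m0 * m) ?_ h⟩
        rw [pow_mul]; exact Ideal.pow_right_mono hm0 m
      have hx1 : w3.v (algebraMap S (Localization.AtPrime N) (algebraMap R S c.x)) ≠ 0 := by
        intro h
        have := (hw4 1 (algebraMap R S c.x ^ e)).mp (by rwa [pow_one])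
        rw [map_pow, w3.v_pow, h, mul_zero] at this
        simp at this
        omega
      obtain ⟨w5, hw5⟩ := exists_restrict _ hinj w3 ⟨_, c.phx0, hx1⟩
      exact c.step_d hxe' hcontr hA hAr hAI hdvd w5 hN3
        (fun m s => by rw [hw4, hw5])


theorem integral_of_mem {R : Type*} [CommRing R] {I : Ideal R} {z : R} (hz : z ∈ I) :
    I.IsIntegralElemOver z := by
  refine ⟨1, one_pos, fun _ => -z, ?_, ?_⟩
  · intro i hi
    have : i = 1 := by simpa using hi
    rw [this, pow_one]; exact I.neg_mem hz
  · simp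

theorem val_sum {R : Type*} [CommRing R] (w : DiscreteValuationOn R) {ι : Type*} (s : Finset ι)
    (f : ι → R) (b : ℕ∞) (h : ∀ i ∈ s, b ≤ w.v (f i)) : b ≤ w.v (∑ i ∈ s, f i) :=
  (w.vIdeal b).sum_mem h

theorem val_of_integral {R : Type*} [CommRing R] (w : DiscreteValuationOn R) {I : Ideal R} {N : ℕ}
    (hI : ∀ m, ∀ z ∈ I ^ m, ((m * N : ℕ) : ℕ∞) ≤ w.v z) {z : R} (hz : I.IsIntegralElemOver z) :
    (N : ℕ∞) ≤ w.v z := by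
  obtain ⟨n, hn, c, hc, h⟩ := hz
  by_contra hcon
  push Not at hcon
  obtain ⟨d, hd⟩ := ENat.ne_top_iff_exists.mp (ne_top_of_lt hcon)
  rw [← hd] at hcon
  have hdN : d < N := by exact_mod_cast hcon
  have h1 : z ^ n = - ∑ i ∈ Finset.Icc 1 n, c i * z ^ (n - i) := eq_neg_of_add_eq_zero_left h
  have h2 : ((n * d + 1 : ℕ) : ℕ∞) ≤ w.v (z ^ n) := by
    rw [h1, w.v_neg]
    apply val_sum
    intro i hi
    rw [w.v_mul, w.v_pow, ← hd]
    have hi' := Finset.mem_Icc.mp hi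
    have h3 := hI i _ (hc i hi)
    have h4 : n * d + 1 ≤ i * N + (n - i) * d := by
      obtain ⟨q, rfl⟩ := Nat.exists_eq_add_of_le hi'.2
      rw [Nat.add_sub_cancel_left]
      have : i * (d + 1) ≤ i * N := Nat.mul_le_mul_left _ hdN
      nlinarith
    calc ((n * d + 1 : ℕ) : ℕ∞) ≤ ((i * N + (n - i) * d : ℕ) : ℕ∞) := by exact_mod_cast h4
      _ = ((i * N : ℕ) : ℕ∞) + ((n - i : ℕ) : ℕ∞) * d := by push_cast; rfl
      _ ≤ _ := by gcongr
  rw [w.v_pow, ← hd] at h2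
  have : n * d + 1 ≤ n * d := by exact_mod_cast h2
  omega

theorem subsingleton_of_unique {R : Type*} [CommRing R] {I : Ideal R}
    {T : Set (DiscreteValuationOn R)} (hT : IsReesValuationsOf I T)
    (hfin : ∀ w ∈ T, valIdeal w I ≠ ⊤)
    (W : DiscreteValuationOn R) {N : ℕ} (hN : 0 < N)
    (hW : ∀ (m : ℕ) (z : R), (∀ w ∈ T, (m : ℕ∞) * valIdeal w I ≤ w.v z) ↔
      ((m * N : ℕ) : ℕ∞) ≤ W.v z) : T.Subsingleton := by
  intro w1 h1 w2 h2
  by_contra hne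
  obtain ⟨-, hT1, hT2⟩ := hT
  have key : ∀ w0 ∈ T, ∃ (x : R) (α : ℕ), W.v x = α ∧
      (∀ w ∈ T, (α : ℕ∞) * valIdeal w I ≤ N * w.v x) ∧
      ∀ w ∈ T, w ≠ w0 → ((α + 1 : ℕ) : ℕ∞) * valIdeal w I ≤ N * w.v x := by
    intro w0 h0
    have hss : T \ {w0} ⊂ T := by
      refine ⟨Set.diff_subset, fun h => ?_⟩
      exact (h h0).2 rfl
    have h3 := hT2 _ hss
    push Not at h3
    obtain ⟨m, x, h4⟩ := h3
    have h5 : (∀ w ∈ T \ {w0}, (m : ℕ∞) * valIdeal w I ≤ w.v x) ∧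
        ¬ (I ^ m).IsIntegralElemOver x := by
      rcases h4 with ⟨ha, w, hw, hlt⟩ | ⟨ha, hb⟩
      · exact absurd ((hT1 m x).mp ha w hw.1) (not_le.mpr hlt)
      · exact ⟨hb, ha⟩
    rw [hT1, hW, not_le] at h5
    obtain ⟨α, hα⟩ := ENat.ne_top_iff_exists.mp (ne_top_of_lt h5.2)
    refine ⟨x, α, hα.symm, ?_, ?_⟩
    · have := (hW α (x ^ N)).mpr (by
        rw [W.v_pow, ← hα, ← Nat.cast_mul, mul_comm])
      intro w hw
      rw [← w.v_pow]; exact this w hw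
    · intro w hw hw0
      have h6 := h5.1 w ⟨hw, hw0⟩
      have h7 : α + 1 ≤ m * N := by
        have := h5.2
        rw [← hα] at this
        have : α < m * N := by exact_mod_cast this
        omega
      calc ((α + 1 : ℕ) : ℕ∞) * valIdeal w I ≤ ((m * N : ℕ) : ℕ∞) * valIdeal w I := by
            gcongr
        _ = N * (m * valIdeal w I) := by push_cast; ring
        _ ≤ _ := by gcongr
  obtain ⟨x1, α, hα, ha1, ha2⟩ := key w1 h1
  obtain ⟨x2, β, hβ, hb1, hb2⟩ := key w2 h2
  have h3 := (hW (α + β + 1) ((x1 * x2) ^ N)).mp (by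
    intro w hw
    rw [w.v_pow, w.v_mul, mul_add]
    by_cases hw1 : w = w1
    · have hw2 : w ≠ w2 := by rw [hw1]; exact hne
      calc ((α + β + 1 : ℕ) : ℕ∞) * valIdeal w I
          = α * valIdeal w I + ((β + 1 : ℕ) : ℕ∞) * valIdeal w I := by push_cast; ring
        _ ≤ _ := add_le_add (ha1 w hw) (hb2 w hw hw2)
    · calc ((α + β + 1 : ℕ) : ℕ∞) * valIdeal w I
          = ((α + 1 : ℕ) : ℕ∞) * valIdeal w I + β * valIdeal w I := by push_cast; ring
        _ ≤ _ := add_le_add (ha2 w hw hw1) (hb1 w hw))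
  rw [W.v_pow, W.v_mul, hα, hβ] at h3
  have h4 : (α + β + 1) * N ≤ N * (α + β) := by exact_mod_cast h3
  nlinarith

theorem rees_aux
    (R : Type u) [CommRing R] [IsLocalRing R] [IsNoetherianRing R]
    (hdim : ringKrullDim R = 2)
    (hreg : ∃ x y : R, maximalIdeal R = Ideal.span {x, y})
    [IsAlgClosed (ResidueField R)]
    (I : Ideal R) (hIc : I.IsComplete) (hIs : I.IsSimpleIdeal) (hIp : I.IsMPrimary)
    (T : Set (DiscreteValuationOn R)) (hT : IsReesValuationsOf I T) :
    ∃ w : DiscreteValuationOn R,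
      (∀ v ∈ T, IsOrdValuationOn v ∨ v = w) ∧ T = {w} := by
  have hTne : T.Nonempty := by
    by_contra hcon
    rw [Set.not_nonempty_iff_eq_empty] at hcon
    have h1 : (I ^ 1).IsIntegralElemOver (1 : R) := by
      rw [hT.2.1 1 1, hcon]; simp
    rw [pow_one] at h1
    exact hIs.1 ((Ideal.eq_top_iff_one _).mpr (hIc 1 h1))
  obtain ⟨w0, hw0⟩ := hTne
  have hdom := w0.isDomain
  have hd : 2 ≤ ringKrullDim R := hdim.ge
  obtain ⟨e, he⟩ := Ideal.exists_pow_le_of_le_radical_of_fg (hIp : I.radical = _).ge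
    (IsNoetherian.noetherian (maximalIdeal R))
  obtain ⟨z0, hz0I, hz0⟩ : ∃ z ∈ I, z ≠ 0 := by
    obtain ⟨x, y, hM⟩ := hreg
    obtain ⟨S, _, _, _, _, c, -, -⟩ := exists_chart hd hM
    exact ⟨c.x ^ e, he (Ideal.pow_mem_pow c.xM e), pow_ne_zero _ c.x0⟩
  have hfin : ∀ w : DiscreteValuationOn R, valIdeal w I ≠ ⊤ := by
    intro w h
    have h1 : valIdeal w I ≤ w.v z0 := iInf₂_le z0 hz0I
    rw [h, top_le_iff] at h1
    exact w.ne_top hz0 h1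
  choose nn hnn using fun w => ENat.ne_top_iff_exists.mp (hfin w)
  have hmem : ∀ z, z ∈ I ↔ ∀ w ∈ T, (nn w : ℕ∞) ≤ w.v z := by
    intro z
    have h1 := hT.2.1 1 z
    rw [pow_one] at h1
    have h2 : z ∈ I ↔ I.IsIntegralElemOver z := ⟨integral_of_mem, hIc z⟩
    rw [h2, h1]
    simp only [hnn, Nat.cast_one, one_mul]
  let ι := {w // w ∈ T ∧ 0 < nn w}
  have hιfin : Finite ι := Set.Finite.subset hT.1 (fun w hw => hw.1 : {w | w ∈ T ∧ 0 < nn w} ⊆ T)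
  obtain ⟨k, hk⟩ : ∃ k, ∀ i : ι, nn i ≤ k := by
    obtain ⟨k, hk⟩ := (Set.finite_range (fun i : ι => nn i)).bddAbove
    exact ⟨k, fun i => hk ⟨i, rfl⟩⟩
  obtain ⟨W, N, hN, hW⟩ := main_ind k R hd hreg ι (fun i => i.1) (fun i => nn i) (fun i => i.2.2) hk I
    (by
      intro z
      rw [hmem]
      constructor
      · intro h i; exact h i.1 i.2.1
      · intro h w hw
        by_cases h0 : 0 < nn w
        · exact h ⟨w, hw, h0⟩
        · have : nn w = 0 := by omega
          rw [this]; simp) ⟨e, he⟩ hIs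
  have hsub := subsingleton_of_unique hT (fun w _ => hfin w) W hN (by
    intro m z
    rw [← hT.2.1 m z, ← hW]
    refine ⟨fun h => ?_, integral_of_mem⟩
    rw [hW]
    apply val_of_integral W ?_ h
    intro j y hy
    rw [← pow_mul, hW] at hy
    rw [← mul_assoc, mul_comm j m]; exact hy)
  have hTeq : T = {w0} := hsub.eq_singleton_of_mem hw0
  refine ⟨w0, ?_, hTeq⟩
  intro v hv
  rw [hTeq] at hv
  exact Or.inr hv



end helpers

/-- Let `(R, M)` be a two-dimensional regular local ring with algebraically closed residue
field and let `I` be a simple complete `M`-primary ideal of `R`.  Then the set `T(I)` of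
Rees valuations of `I` consists of exactly one valuation `w`; in particular `T(I)` is
contained in `{v_M, w}` and in fact `T(I) = {w}`. -/
theorem rees_valuations_of_simple_complete
    (R : Type*) [CommRing R] [IsLocalRing R] [IsNoetherianRing R]
    (hdim : ringKrullDim R = 2)
    (hreg : ∃ x y : R, maximalIdeal R = Ideal.span {x, y})
    [IsAlgClosed (ResidueField R)]
    (I : Ideal R) (hIc : I.IsComplete) (hIs : I.IsSimpleIdeal) (hIp : I.IsMPrimary)
    (T : Set (DiscreteValuationOn R)) (hT : IsReesValuationsOf I T) :
    ∃ w : DiscreteValuationOn R,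
      (∀ v ∈ T, IsOrdValuationOn v ∨ v = w) ∧ T = {w} := by
  exact rees_aux R hdim hreg I hIc hIs hIp T hT
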